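/- For every positive integer n, the number of representations of n by x1^2 + x2^2 + x3^2 + x4^2 + 2(x5^2+x6^2+x7^2) + 4x8^2 equals (32/11)σ_{3;χ8,1}(n) + (2/11)σ_{3;1,χ8}(n/2) + (8/11)a1(n) + (48/11)a2(n) + (136/11)a1(n/2) + (16/11)a2(n/2), with terms of non-integer argument interpreted as 0. -/

import Mathlib

open Complex Real Finset

/-- The Dedekind eta function `η(z) = q^{1/24} ∏ (1 - q^m)`, `q = e^{2πiz}`. -/
noncomputable def dedekindEta (z : ℂ) : ℂ :=
  Complex.exp (Real.pi * Complex.I * z / 12) *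
    ∏' m : ℕ, (1 - Complex.exp (2 * Real.pi * Complex.I * (m + 1) * z))

/-- `repCount a n` is the number of `(x₁,…,x₈) ∈ ℤ⁸` with `∑ aᵢ xᵢ² = n`. -/
noncomputable def repCount (a : Fin 8 → ℕ) (n : ℕ) : ℕ :=
  Nat.card {x : Fin 8 → ℤ // ∑ i, (a i : ℤ) * x i ^ 2 = (n : ℤ)}

/-- `σ_{3;1,χ₈}(n) = ∑_{d ∣ n} χ₈(d) d³`. -/
def sigmaOneChi8 (n : ℕ) : ℤ := ∑ d ∈ n.divisors, ZMod.χ₈ (d : ZMod 8) * (d : ℤ) ^ 3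

/-- `σ_{3;χ₈,1}(n) = ∑_{d ∣ n} χ₈(n/d) d³`. -/
def sigmaChi8One (n : ℕ) : ℤ := ∑ d ∈ n.divisors, ZMod.χ₈ ((n / d : ℕ) : ZMod 8) * (d : ℤ) ^ 3

/-- `f(n/2)` when `2 ∣ n`, and `0` otherwise. -/
def half (f : ℕ → ℤ) (n : ℕ) : ℚ := if 2 ∣ n then (f (n / 2) : ℚ) else 0

/-- Gaussian bound: all theta-type series converge absolutely. -/
lemma rf_gsum {q y : ℂ} (hq : q ≠ 0) (hq1 : ‖q‖ < 1) (hy : y ≠ 0) (k : ℕ) :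
    Summable fun j : ℤ => ‖(j : ℂ) ^ k * (q ^ (j ^ 2) * y ^ j)‖ := by
  have hn : 0 < ‖q‖ := norm_pos_iff.mpr hq
  have hyn : 0 < ‖y‖ := norm_pos_iff.mpr hy
  set T : ℝ := -Real.log ‖q‖ / π with hT
  set S : ℝ := |Real.log ‖y‖| / (2 * π) with hS
  have hTpos : 0 < T := div_pos (neg_pos.mpr (Real.log_neg hn hq1)) Real.pi_pos
  refine Summable.of_nonneg_of_le (fun _ => norm_nonneg _) ?_
    (summable_pow_mul_jacobiTheta₂_term_bound S hTpos k)
  intro j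
  have hpi := Real.pi_pos.ne'
  have e1 : ‖q‖ ^ (j ^ 2 : ℤ) = Real.exp (-π * (T * j ^ 2)) := by
    rw [← Real.rpow_intCast, Real.rpow_def_of_pos hn]
    congr 1
    rw [hT]; push_cast; field_simp
  have e2 : ‖y‖ ^ (j : ℤ) ≤ Real.exp (π * (2 * S * |(j : ℝ)|)) := by
    rw [← Real.rpow_intCast, Real.rpow_def_of_pos hyn]
    apply Real.exp_le_exp.mpr
    have : π * (2 * S * |(j : ℝ)|) = |Real.log ‖y‖ * j| := by
      rw [hS, abs_mul]; field_simp
    rw [this]; exact le_abs_self _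
  rw [norm_mul, norm_pow, norm_mul, norm_zpow, norm_zpow, e1]
  have e3 : ‖(j : ℂ)‖ = |(j : ℝ)| := by
    rw [← Complex.ofReal_intCast, Complex.norm_real, Real.norm_eq_abs]
  rw [e3]
  have e4 : Real.exp (-π * (T * (j : ℝ) ^ 2 - 2 * S * |(j : ℝ)|)) =
      Real.exp (-π * (T * j ^ 2)) * Real.exp (π * (2 * S * |(j : ℝ)|)) := by
    rw [← Real.exp_add]; congr 1; ring
  have e5 : (|j| : ℤ) = |(j : ℝ)| := by push_cast; rfl
  rw [e5, e4]
  gcongr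

lemma rf_gsum' {q y : ℂ} (hq : q ≠ 0) (hq1 : ‖q‖ < 1) (hy : y ≠ 0) (k : ℕ) :
    Summable fun j : ℤ => (j : ℂ) ^ k * (q ^ (j ^ 2) * y ^ j) :=
  (rf_gsum hq hq1 hy k).of_norm

lemma rf_gsum0 {q y : ℂ} (hq : q ≠ 0) (hq1 : ‖q‖ < 1) (hy : y ≠ 0) :
    Summable fun j : ℤ => ‖q ^ (j ^ 2) * y ^ j‖ := by
  simpa using rf_gsum hq hq1 hy 0

lemma rf_geo {g : ℤ → ℂ} {C r : ℝ} (hr0 : 0 ≤ r) (hr : r < 1)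
    (h : ∀ d, ‖g d‖ ≤ C * r ^ d.natAbs) (k : ℕ) :
    Summable fun d : ℤ => ‖(d : ℂ) ^ k * g d‖ := by
  have hs : Summable fun n : ℕ => C * ((n : ℝ) ^ k * r ^ n) := by
    apply Summable.mul_left
    exact summable_pow_mul_geometric_of_norm_lt_one k (by rwa [Real.norm_of_nonneg hr0])
  have hb : ∀ d : ℤ, ‖(d : ℂ) ^ k * g d‖ ≤ C * ((d.natAbs : ℝ) ^ k * r ^ d.natAbs) := by
    intro d
    have e3 : ‖(d : ℂ)‖ = (d.natAbs : ℝ) := by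
      rw [← Complex.ofReal_intCast, Complex.norm_real, Real.norm_eq_abs, Nat.cast_natAbs]
      push_cast; rfl
    rw [norm_mul, norm_pow, e3]
    calc _ ≤ (d.natAbs : ℝ) ^ k * (C * r ^ d.natAbs) := by
          gcongr; exact h d
      _ = _ := by ring
  refine Summable.of_nonneg_of_le (fun _ => norm_nonneg _) hb ?_
  rw [summable_int_iff_summable_nat_and_neg]
  constructor <;> simpa using hs

/-- Euler product. -/
noncomputable def rfP (q : ℂ) : ℂ := ∏' m : ℕ, (1 - q ^ (m + 1))

/-- finite q-Pochhammer -/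
noncomputable def rfPn (q : ℂ) (n : ℕ) : ℂ := ∏ m ∈ Finset.range n, (1 - q ^ (m + 1))

lemma rf_one_sub_ne {q : ℂ} (hq1 : ‖q‖ < 1) {n : ℕ} (hn : n ≠ 0) : 1 - q ^ n ≠ 0 := by
  intro h
  have : ‖q ^ n‖ = 1 := by rw [← sub_eq_zero.mp h]; simp
  rw [norm_pow] at this
  exact absurd this (pow_lt_one₀ (norm_nonneg _) hq1 hn).ne

lemma rfPn_ne {q : ℂ} (hq1 : ‖q‖ < 1) (n : ℕ) : rfPn q n ≠ 0 :=
  Finset.prod_ne_zero_iff.mpr fun m _ => rf_one_sub_ne hq1 (Nat.succ_ne_zero m)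

lemma rfPn_succ (q : ℂ) (n : ℕ) : rfPn q (n + 1) = rfPn q n * (1 - q ^ (n + 1)) :=
  Finset.prod_range_succ _ _

lemma rfPn_tendsto {q : ℂ} (hq1 : ‖q‖ < 1) :
    Filter.Tendsto (rfPn q) Filter.atTop (nhds (rfP q)) := by
  have := (ModularForm.multipliable_one_sub_pow hq1).hasProd.tendsto_prod_nat
  exact this

lemma rfP_ne {q : ℂ} (hq1 : ‖q‖ < 1) : rfP q ≠ 0 := by
  unfold rfP
  have := tprod_one_add_ne_zero_of_summable (f := fun m : ℕ => -q ^ (m + 1))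
    (by intro m; rw [← sub_eq_add_neg]; exact rf_one_sub_ne hq1 (Nat.succ_ne_zero m))
    (by
      simp only [norm_neg, norm_pow]
      exact (summable_nat_add_iff 1).mpr (summable_geometric_of_lt_one (norm_nonneg _) hq1))
  simpa [sub_eq_add_neg] using this

/-- inverse Pochhammer extended by zero to negative integers -/
noncomputable def rfip (p : ℂ) (m : ℤ) : ℂ := if m < 0 then 0 else (rfPn p m.toNat)⁻¹

lemma rfip_rec {p : ℂ} (hp1 : ‖p‖ < 1) (m : ℤ) :
    rfip p (m - 1) = (1 - p ^ m) * rfip p m := by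
  unfold rfip
  rcases lt_trichotomy m 0 with h | h | h
  · rw [if_pos (by omega), if_pos h, mul_zero]
  · subst h; simp
  · obtain ⟨n, rfl⟩ : ∃ n : ℕ, m = n + 1 := ⟨(m - 1).toNat, by omega⟩
    rw [if_neg (by omega), if_neg (by omega)]
    have e1 : ((n : ℤ) + 1 - 1).toNat = n := by omega
    have e2 : ((n : ℤ) + 1).toNat = n + 1 := by omega
    rw [e1, e2, rfPn_succ]
    have h1 := rfPn_ne hp1 n
    have h2 := rf_one_sub_ne hp1 (Nat.succ_ne_zero n)
    have e3 : p ^ ((n : ℤ) + 1) = p ^ (n + 1) := by norm_cast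
    rw [e3]
    field_simp

lemma rfip_tendsto {p : ℂ} (hp1 : ‖p‖ < 1) (j : ℤ) :
    Filter.Tendsto (fun n : ℕ => rfip p ((n : ℤ) + j)) Filter.atTop (nhds (rfP p)⁻¹) := by
  have h1 := (rfPn_tendsto hp1).inv₀ (rfP_ne hp1)
  have h2 : Filter.Tendsto (fun n : ℕ => ((n : ℤ) + j).toNat) Filter.atTop Filter.atTop := by
    apply Filter.tendsto_atTop.mpr
    intro b
    filter_upwards [Filter.eventually_ge_atTop (b + j.natAbs)] with n hn
    omega
  refine (h1.comp h2).congr' ?_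
  filter_upwards [Filter.eventually_ge_atTop (j.natAbs)] with n hn
  simp only [Function.comp, rfip]
  rw [if_neg (by omega)]

lemma rfip_bdd {p : ℂ} (hp1 : ‖p‖ < 1) : ∃ C, ∀ m, ‖rfip p m‖ ≤ C := by
  have h1 := (rfPn_tendsto hp1).inv₀ (rfP_ne hp1)
  obtain ⟨C, hC⟩ := (Metric.isBounded_range_of_tendsto _ h1).exists_norm_le
  refine ⟨C, fun m => ?_⟩
  unfold rfip
  split_ifs
  · simpa using (norm_nonneg _).trans (hC _ ⟨0, rfl⟩)
  · exact hC _ ⟨_, rfl⟩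

lemma rfPn_bdd {p : ℂ} (hp1 : ‖p‖ < 1) : ∃ C, ∀ m, ‖rfPn p m‖ ≤ C := by
  obtain ⟨C, hC⟩ := (Metric.isBounded_range_of_tendsto _ (rfPn_tendsto hp1)).exists_norm_le
  exact ⟨C, fun m => hC _ ⟨_, rfl⟩⟩

/-- finite triple product coefficient -/
noncomputable def rfB (r : ℂ) (n : ℕ) (j : ℤ) : ℂ :=
  rfPn (r ^ 2) (2 * n) * rfip (r ^ 2) (n - j) * rfip (r ^ 2) (n + j)

noncomputable def rfA (r : ℂ) (n : ℕ) (j : ℤ) : ℂ := (r ^ (j ^ 2) * (-r⁻¹) ^ j) * rfB r n j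

lemma rfA_rec {r : ℂ} (hr : r ≠ 0) (hr1 : ‖r‖ < 1) (n : ℕ) (j : ℤ) :
    rfA r (n + 1) j = (1 + (r ^ 2) ^ (2 * n + 1)) * rfA r n j - (r ^ 2) ^ n * rfA r n (j - 1)
      - (r ^ 2) ^ (n + 1) * rfA r n (j + 1) := by
  have hp1 : ‖r ^ 2‖ < 1 := by rw [norm_pow]; exact pow_lt_one₀ (norm_nonneg _) hr1 two_ne_zero
  have hp : r ^ 2 ≠ 0 := pow_ne_zero _ hr
  have hri : -r⁻¹ ≠ 0 := by simpa using hr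
  unfold rfA rfB
  set X := rfip (r ^ 2) (n + 1 - j) with hX
  set Y := rfip (r ^ 2) (n + 1 + j) with hY
  set α := (r ^ 2) ^ ((n : ℤ) + 1 - j) with hα
  set β := (r ^ 2) ^ ((n : ℤ) + 1 + j) with hβ
  have hα' : (r ^ 2) ^ ((n : ℤ) - j) = α / r ^ 2 := by
    rw [hα, eq_div_iff hp, ← zpow_add_one₀ hp]; congr 1; ring
  have hβ' : (r ^ 2) ^ ((n : ℤ) + j) = β / r ^ 2 := by
    rw [hβ, eq_div_iff hp, ← zpow_add_one₀ hp]; congr 1; ring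
  have x1 : rfip (r ^ 2) (n - j) = (1 - α) * X := by
    rw [hX, hα, ← rfip_rec hp1]; congr 1; ring
  have y1 : rfip (r ^ 2) (n + j) = (1 - β) * Y := by
    rw [hY, hβ, ← rfip_rec hp1]; congr 1; ring
  have x2 : rfip (r ^ 2) (n - (j + 1)) = (1 - α / r ^ 2) * ((1 - α) * X) := by
    rw [← x1, ← hα', ← rfip_rec hp1]; congr 1; ring
  have y2 : rfip (r ^ 2) (n + (j - 1)) = (1 - β / r ^ 2) * ((1 - β) * Y) := by
    rw [← y1, ← hβ', ← rfip_rec hp1]; congr 1; ring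
  have x3 : rfip (r ^ 2) (n - (j - 1)) = X := by rw [hX]; congr 1; ring
  have y3 : rfip (r ^ 2) (n + (j + 1)) = Y := by rw [hY]; congr 1; ring
  have x4 : rfip (r ^ 2) ((n + 1 : ℕ) - j) = X := by rw [hX]; push_cast; rfl
  have y4 : rfip (r ^ 2) ((n + 1 : ℕ) + j) = Y := by rw [hY]; push_cast; rfl
  rw [x1, y1, x2, y2, x3, y3, x4, y4]
  have pp : rfPn (r ^ 2) (2 * (n + 1)) =
      rfPn (r ^ 2) (2 * n) * (1 - (r ^ 2) ^ (2 * n + 1)) * (1 - (r ^ 2) ^ (2 * n + 2)) := by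
    rw [show 2 * (n + 1) = 2 * n + 1 + 1 by ring, rfPn_succ, rfPn_succ]
  rw [pp]
  have ab : (r ^ 2) ^ (2 * n + 2) = α * β := by
    rw [hα, hβ, ← zpow_add₀ hp, ← zpow_natCast]; congr 1; push_cast; ring
  have ab' : (r ^ 2) ^ (2 * n + 1) = α * β / r ^ 2 := by
    rw [← ab, eq_div_iff hp, ← pow_succ]
  -- shifts of the Gaussian factor
  set E := r ^ (j ^ 2) * (-r⁻¹) ^ j with hE
  have s1 : (r ^ 2) ^ n * (r ^ ((j - 1) ^ 2) * (-r⁻¹) ^ (j - 1)) = -(α * E) := by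
    rw [hE, hα, zpow_sub₀ hri, zpow_one, show (j - 1) ^ 2 = j ^ 2 + (1 - 2 * j) by ring,
      zpow_add₀ hr, ← zpow_natCast (r ^ 2) n, ← zpow_natCast r 2, ← zpow_mul, ← zpow_mul,
      show ((2 : ℕ) : ℤ) * ((n : ℤ) + 1 - j) = (2 : ℕ) * (n : ℤ) + (1 - 2 * j) + 1 by push_cast; ring,
      zpow_add_one₀ hr, zpow_add₀ hr]
    field_simp
  have s2 : (r ^ 2) ^ (n + 1) * (r ^ ((j + 1) ^ 2) * (-r⁻¹) ^ (j + 1)) = -(β * E) := by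
    rw [hE, hβ, zpow_add₀ hri, zpow_one, show (j + 1) ^ 2 = j ^ 2 + (1 + 2 * j) by ring,
      zpow_add₀ hr, ← zpow_natCast (r ^ 2) (n + 1), ← zpow_natCast r 2, ← zpow_mul, ← zpow_mul,
      show ((2 : ℕ) : ℤ) * ((n : ℤ) + 1 + j) = (2 : ℕ) * ((n + 1 : ℕ) : ℤ) + (1 + 2 * j) - 1 by
        push_cast; ring,
      zpow_sub_one₀ hr, zpow_add₀ hr ((2 : ℕ) * ((n + 1 : ℕ) : ℤ)) (1 + 2 * j)]
    field_simp
  rw [ab, ab', show ∀ u v w : ℂ, (r ^ 2) ^ n * (u * v * w) = ((r ^ 2) ^ n * (u * v)) * w by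
    intros; ring, show ∀ u v w : ℂ, (r ^ 2) ^ (n + 1) * (u * v * w) =
      ((r ^ 2) ^ (n + 1) * (u * v)) * w by intros; ring, s1, s2]
  field_simp
  ring

lemma rfA_zero (r : ℂ) (j : ℤ) : rfA r 0 j = if j = 0 then 1 else 0 := by
  unfold rfA rfB rfip
  by_cases h : j = 0
  · subst h; simp [rfPn]
  · rw [if_neg h]
    rcases lt_or_gt_of_ne h with h | h
    · simp [h]
    · simp [h]

lemma rf_hcongr {ι : Type*} {f f' : ι → ℂ} {s s' : ℂ} (h : HasSum f s) (hf : ∀ j, f' j = f j)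
    (hs : s' = s) : HasSum f' s' := by
  rw [hs, funext hf]; exact h

lemma rf_shift {f : ℤ → ℂ} {s : ℂ} (h : HasSum f s) (m : ℤ) : HasSum (fun j => f (j + m)) s :=
  (Equiv.addRight m).hasSum_iff.mpr h

lemma rf_finite_triple {r : ℂ} (hr : r ≠ 0) (hr1 : ‖r‖ < 1) {y : ℂ} (hy : y ≠ 0) (n : ℕ) :
    HasSum (fun j : ℤ => rfA r n j * y ^ j)
      (∏ k ∈ Finset.range n, ((1 - y * (r ^ 2) ^ k) * (1 - (r ^ 2) ^ (k + 1) / y))) := by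
  induction n with
  | zero =>
    simp only [rfA_zero, Finset.range_zero, Finset.prod_empty]
    convert hasSum_single (0 : ℤ) ?_ using 1
    · simp
    · intro j hj; simp [hj]
  | succ n ih =>
    rw [Finset.prod_range_succ]
    have h1 := ih.mul_left (1 + (r ^ 2) ^ (2 * n + 1))
    have h2 := (rf_shift ih (-1)).mul_left ((r ^ 2) ^ n * y)
    have h3 := (rf_shift ih 1).mul_left ((r ^ 2) ^ (n + 1) / y)
    refine rf_hcongr ((h1.sub h2).sub h3) ?_ ?_
    · intro j
      rw [rfA_rec hr hr1, zpow_add₀ hy, zpow_add₀ hy, zpow_one, zpow_neg_one, ← sub_eq_add_neg]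
      field_simp
    · field_simp
      ring

lemma rf_finite_moment {r : ℂ} (hr : r ≠ 0) (hr1 : ‖r‖ < 1) (n : ℕ) :
    HasSum (fun j : ℤ => rfA r (n + 1) j) 0 ∧
    HasSum (fun j : ℤ => (j : ℂ) * rfA r (n + 1) j) (-(rfPn (r ^ 2) n * rfPn (r ^ 2) (n + 1))) := by
  induction n with
  | zero =>
    have hA : HasSum (fun j : ℤ => rfA r 0 j) 1 := by
      simpa using rf_finite_triple hr hr1 one_ne_zero 0
    have hM : HasSum (fun j : ℤ => (j : ℂ) * rfA r 0 j) 0 := by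
      convert hasSum_zero using 1
      ext j; rw [rfA_zero]; by_cases h : j = 0 <;> simp [h]
    constructor
    · simpa using rf_finite_triple hr hr1 one_ne_zero 1
    · have h1 := hM.mul_left (1 + (r ^ 2) ^ (2 * 0 + 1))
      have h2 := (rf_shift (hM.add hA) (-1)).mul_left ((r ^ 2) ^ 0)
      have h3 := (rf_shift (hM.sub hA) 1).mul_left ((r ^ 2) ^ (0 + 1))
      refine rf_hcongr ((h1.sub h2).sub h3) ?_ ?_
      · intro j
        rw [rfA_rec hr hr1]; push_cast [← sub_eq_add_neg]; ring
      · simp [rfPn]; ring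
  | succ n ih =>
    obtain ⟨hA, hM⟩ := ih
    constructor
    · convert rf_finite_triple hr hr1 one_ne_zero (n + 1 + 1) using 1
      · simp
      · rw [Finset.prod_range_succ', pow_zero]; simp
    · have h1 := hM.mul_left (1 + (r ^ 2) ^ (2 * (n + 1) + 1))
      have h2 := (rf_shift (hM.add hA) (-1)).mul_left ((r ^ 2) ^ (n + 1))
      have h3 := (rf_shift (hM.sub hA) 1).mul_left ((r ^ 2) ^ (n + 1 + 1))
      refine rf_hcongr ((h1.sub h2).sub h3) ?_ ?_
      · intro j
        rw [rfA_rec hr hr1]; push_cast [← sub_eq_add_neg]; ring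
      · rw [rfPn_succ _ (n + 1), rfPn_succ]; ring

lemma rfA_lim {r : ℂ} (hr1 : ‖r‖ < 1) (j : ℤ) :
    Filter.Tendsto (fun n => rfA r n j) Filter.atTop
      (nhds ((r ^ (j ^ 2) * (-r⁻¹) ^ j) * (rfP (r ^ 2))⁻¹)) := by
  have hp1 : ‖r ^ 2‖ < 1 := by rw [norm_pow]; exact pow_lt_one₀ (norm_nonneg _) hr1 two_ne_zero
  unfold rfA rfB
  apply Filter.Tendsto.const_mul
  have h1 := (rfPn_tendsto hp1).comp (Filter.tendsto_id.const_mul_atTop' (r := 2) (by norm_num))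
  have h2 := rfip_tendsto hp1 (-j)
  have h3 := rfip_tendsto hp1 j
  have := (h1.mul h2).mul h3
  have hP := rfP_ne hp1
  rw [show rfP (r ^ 2) * (rfP (r ^ 2))⁻¹ * (rfP (r ^ 2))⁻¹ = (rfP (r ^ 2))⁻¹ by field_simp] at this
  simpa [← sub_eq_add_neg] using this

lemma rfB_bdd {r : ℂ} (hr1 : ‖r‖ < 1) : ∃ C, ∀ n j, ‖rfB r n j‖ ≤ C := by
  have hp1 : ‖r ^ 2‖ < 1 := by rw [norm_pow]; exact pow_lt_one₀ (norm_nonneg _) hr1 two_ne_zero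
  obtain ⟨C, hC⟩ := rfip_bdd hp1
  obtain ⟨D, hD⟩ := rfPn_bdd hp1
  have hC0 : 0 ≤ C := (norm_nonneg _).trans (hC 0)
  have hD0 : 0 ≤ D := (norm_nonneg _).trans (hD 0)
  refine ⟨D * C * C, fun n j => ?_⟩
  unfold rfB
  rw [norm_mul, norm_mul]
  gcongr <;> apply_assumption

lemma rf_tannery {r : ℂ} (hr : r ≠ 0) (hr1 : ‖r‖ < 1) {y : ℂ} (hy : y ≠ 0) (k : ℕ) {u : ℕ → ℂ} {l : ℂ}
    (hu : ∀ᶠ n in Filter.atTop, HasSum (fun j : ℤ => (j : ℂ) ^ k * (rfA r n j * y ^ j)) (u n))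
    (hl : Filter.Tendsto u Filter.atTop (nhds l)) :
    ∑' j : ℤ, (j : ℂ) ^ k * (r ^ (j ^ 2) * (-r⁻¹ * y) ^ j) = rfP (r ^ 2) * l := by
  have hp1 : ‖r ^ 2‖ < 1 := by rw [norm_pow]; exact pow_lt_one₀ (norm_nonneg _) hr1 two_ne_zero
  have hri : -r⁻¹ * y ≠ 0 := by simp [hr, hy]
  obtain ⟨C, hC⟩ := rfB_bdd hr1
  have key := tendsto_tsum_of_dominated_convergence (𝓕 := Filter.atTop)
    (f := fun (n : ℕ) (j : ℤ) => (j : ℂ) ^ k * (rfA r n j * y ^ j))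
    (g := fun j : ℤ => (j : ℂ) ^ k * ((r ^ (j ^ 2) * (-r⁻¹) ^ j) * (rfP (r ^ 2))⁻¹ * y ^ j))
    (bound := fun j : ℤ => ‖(j : ℂ) ^ k * (r ^ (j ^ 2) * (-r⁻¹ * y) ^ j)‖ * C)
    ((rf_gsum hr hr1 hri k).mul_right C)
    (fun j => ((rfA_lim hr1 j).mul_const _).const_mul _)
    (Filter.Eventually.of_forall fun n j => by
      rw [show (j : ℂ) ^ k * (rfA r n j * y ^ j) =
        ((j : ℂ) ^ k * (r ^ (j ^ 2) * (-r⁻¹ * y) ^ j)) * rfB r n j by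
          unfold rfA; rw [mul_zpow]; ring, norm_mul]
      gcongr; exact hC n j)
  have h2 : Filter.Tendsto (fun n : ℕ => ∑' j : ℤ, (j : ℂ) ^ k * (rfA r n j * y ^ j)) Filter.atTop
      (nhds l) := hl.congr' (by filter_upwards [hu] with n hn; exact hn.tsum_eq.symm)
  have h3 := tendsto_nhds_unique key h2
  have hP := rfP_ne hp1
  rw [← h3, ← tsum_mul_left]
  congr 1; ext j
  rw [mul_zpow]; field_simp

/-- Jacobi: -∑ j (-1)^j r^{j²-j} = P(r²)³ -/
lemma rf_jacobi {r : ℂ} (hr : r ≠ 0) (hr1 : ‖r‖ < 1) :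
    ∑' j : ℤ, (j : ℂ) * (r ^ (j ^ 2) * (-r⁻¹) ^ j) = -rfP (r ^ 2) ^ 3 := by
  have hp1 : ‖r ^ 2‖ < 1 := by rw [norm_pow]; exact pow_lt_one₀ (norm_nonneg _) hr1 two_ne_zero
  have h := rf_tannery hr hr1 one_ne_zero 1 (u := fun n => -(rfPn (r ^ 2) (n - 1) * rfPn (r ^ 2) n))
    (l := -(rfP (r ^ 2) * rfP (r ^ 2))) ?_ ?_
  · simp only [pow_one, mul_one] at h
    rw [h]; ring
  · filter_upwards [Filter.eventually_ge_atTop 1] with n hn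
    obtain ⟨m, rfl⟩ : ∃ m, n = m + 1 := ⟨n - 1, by omega⟩
    simpa using (rf_finite_moment hr hr1 m).2
  · exact (((rfPn_tendsto hp1).comp (Filter.tendsto_sub_atTop_nat 1)).mul (rfPn_tendsto hp1)).neg

/-- Jacobi triple product -/
lemma rf_triple {r : ℂ} (hr : r ≠ 0) (hr1 : ‖r‖ < 1) {y : ℂ} (hy : y ≠ 0) {l : ℂ}
    (hl : Filter.Tendsto (fun n => ∏ k ∈ Finset.range n, ((1 - y * (r ^ 2) ^ k) *
      (1 - (r ^ 2) ^ (k + 1) / y))) Filter.atTop (nhds l)) :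
    ∑' j : ℤ, (r ^ (j ^ 2) * (-r⁻¹ * y) ^ j) = rfP (r ^ 2) * l := by
  have h := rf_tannery hr hr1 hy 0 (Filter.Eventually.of_forall fun n => by
    simpa using rf_finite_triple hr hr1 hy n) hl
  simpa using h

noncomputable def rfTh (k : ℕ) (q y : ℂ) : ℂ := ∑' j : ℤ, (j : ℂ) ^ k * (q ^ (j ^ 2) * y ^ j)

noncomputable def rfJ (m : ℕ) (q : ℂ) : ℂ :=
  ∑' i : ℤ, ((2 * i + 1 : ℤ) : ℂ) ^ m * (q ^ (i ^ 2) * (-q) ^ i)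

lemma rfTh_hasSum {q y : ℂ} (hq : q ≠ 0) (hq1 : ‖q‖ < 1) (hy : y ≠ 0) (k : ℕ) :
    HasSum (fun j : ℤ => (j : ℂ) ^ k * (q ^ (j ^ 2) * y ^ j)) (rfTh k q y) :=
  (rf_gsum' hq hq1 hy k).hasSum

lemma rfTh_hasSum0 {q y : ℂ} (hq : q ≠ 0) (hq1 : ‖q‖ < 1) (hy : y ≠ 0) :
    HasSum (fun j : ℤ => (q ^ (j ^ 2) * y ^ j)) (rfTh 0 q y) := by
  simpa using rfTh_hasSum hq hq1 hy 0

lemma rf_neg {f : ℤ → ℂ} {s : ℂ} (h : HasSum f s) : HasSum (fun j => f (-j)) s :=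
  (Equiv.neg ℤ).hasSum_iff.mpr h

lemma rf_odd_zero {f : ℤ → ℂ} (h : ∀ j, f (-j) = -f j) : ∑' j, f j = 0 := by
  have h1 : ∑' j, f (-j) = ∑' j, f j := (Equiv.neg ℤ).tsum_eq f
  simp only [h, tsum_neg] at h1
  linear_combination (-1 / 2) * h1

/-- vanishing of ∑ (-1)^j q^{j²+mj} for odd m -/
lemma rf_vanish {q : ℂ} (hq : q ≠ 0) (hq1 : ‖q‖ < 1) (m : ℤ) (hm : Odd m) :
    HasSum (fun j : ℤ => q ^ (j ^ 2) * (-q ^ m) ^ j) 0 := by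
  have hy : -q ^ m ≠ 0 := neg_ne_zero.mpr (zpow_ne_zero _ hq)
  have h := rfTh_hasSum0 hq hq1 hy
  have h2 := rf_neg (rf_shift h (-m))
  have h3 : HasSum (fun j : ℤ => -(q ^ (j ^ 2) * (-q ^ m) ^ j)) (rfTh 0 q (-q ^ m)) := by
    refine rf_hcongr h2 (fun j => ?_) rfl
    have e : (-1 : ℂ) ^ (-j + -m) = -(-1) ^ j := by
      rw [zpow_add₀ (by norm_num), Odd.neg_one_zpow hm.neg, zpow_neg, ← inv_zpow]; norm_num
    rw [neg_eq_neg_one_mul (q ^ m), mul_zpow, mul_zpow, e, ← zpow_mul, ← zpow_mul]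
    have : q ^ ((-j + -m) ^ 2) * q ^ (m * (-j + -m)) = q ^ (j ^ 2) * q ^ (m * j) := by
      rw [← zpow_add₀ hq, ← zpow_add₀ hq]; congr 1; ring
    linear_combination (-1 : ℂ) ^ j * this
  have h4 := h.neg.unique h3
  have : rfTh 0 q (-q ^ m) = 0 := by linear_combination (-1 / 2) * h4
  rwa [this] at h

/-- reindexing a double sum along (k,j) ↦ (k - l j, j) -/
lemma rf_conv {F : ℤ × ℤ → ℂ} {s : ℂ} (h : HasSum F s) (l : ℤ) :
    HasSum (fun k : ℤ => ∑' j : ℤ, F (k - l * j, j)) s := by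
  let e : ℤ × ℤ ≃ ℤ × ℤ :=
    { toFun := fun x => (x.1 - l * x.2, x.2)
      invFun := fun x => (x.1 + l * x.2, x.2)
      left_inv := fun x => by simp
      right_inv := fun x => by simp }
  have h1 : HasSum (fun x : ℤ × ℤ => F (x.1 - l * x.2, x.2)) s := e.hasSum_iff.mpr h
  exact h1.prod_fiberwise fun k => (h1.summable.prod_factor k).hasSum

lemma rf_prod {f g : ℤ → ℂ} (hf : Summable fun d => ‖f d‖) (hg : Summable fun d => ‖g d‖) :
    HasSum (fun x : ℤ × ℤ => f x.1 * g x.2) ((∑' d, f d) * ∑' j, g j) := by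
  rw [tsum_mul_tsum_of_summable_norm hf hg]
  exact (summable_mul_of_summable_norm hf hg).hasSum

lemma rf_moment {g D : ℤ → ℂ} (l : ℤ) (hg : ∀ k : ℕ, Summable fun d : ℤ => ‖(d : ℂ) ^ k * g d‖)
    (hD : ∀ k : ℕ, Summable fun d : ℤ => ‖(d : ℂ) ^ k * D d‖)
    (go : ∀ d, g (-d) = -g d) (De : ∀ d, D (-d) = D d) :
    HasSum (fun k : ℤ => (k : ℂ) * ∑' j, g (k - l * j) * D j) ((∑' d : ℤ, (d : ℂ) * g d) * ∑' j, D j) ∧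
    HasSum (fun k : ℤ => (k : ℂ) ^ 3 * ∑' j, g (k - l * j) * D j)
      ((∑' d : ℤ, (d : ℂ) ^ 3 * g d) * (∑' j, D j) +
        3 * l ^ 2 * (∑' d : ℤ, (d : ℂ) * g d) * (∑' j : ℤ, (j : ℂ) ^ 2 * D j)) := by
  have P := fun i j : ℕ => rf_prod (hg i) (hD j)
  have g0 : ∑' d : ℤ, (d : ℂ) ^ 0 * g d = 0 := rf_odd_zero fun j => by simp [go]
  have g2 : ∑' d : ℤ, (d : ℂ) ^ 2 * g d = 0 := rf_odd_zero fun j => by simp [go]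
  have D1 : ∑' d : ℤ, (d : ℂ) ^ 1 * D d = 0 := rf_odd_zero fun j => by simp [De]
  have D3 : ∑' d : ℤ, (d : ℂ) ^ 3 * D d = 0 := rf_odd_zero fun j => by
    simp only [De, Int.cast_neg]; ring
  constructor
  · have h := rf_conv ((P 1 0).add ((P 0 1).mul_left (l : ℂ))) l
    refine rf_hcongr h (fun k => ?_) ?_
    · rw [← tsum_mul_left]
      congr 1; ext j; push_cast; ring
    · rw [D1]; simp
  · have h := rf_conv ((((P 3 0).add ((P 2 1).mul_left (3 * l : ℂ))).add
      ((P 1 2).mul_left (3 * l ^ 2 : ℂ))).add ((P 0 3).mul_left (l ^ 3 : ℂ))) l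
    refine rf_hcongr h (fun k => ?_) ?_
    · rw [← tsum_mul_left]
      congr 1; ext j; push_cast; ring
    · rw [D1, D3]
      simp only [pow_zero, one_mul, pow_one]; ring

lemma rf_step_sum (j : ℤ) :
    HasSum (fun k : ℤ => (if j ≤ k then (1 : ℂ) else 0) - (if 0 ≤ k then 1 else 0)) (-j) := by
  rcases le_total 0 j with h | h
  · have := hasSum_sum_of_ne_finset_zero (L := SummationFilter.unconditional ℤ) (s := Finset.Ico 0 j)
      (f := fun k : ℤ => (if j ≤ k then (1 : ℂ) else 0) - (if 0 ≤ k then 1 else 0)) (by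
        intro k hk
        simp only [Finset.mem_Ico, not_and, not_lt] at hk
        by_cases h0 : 0 ≤ k
        · simp [h0, hk h0]
        · simp [h0, show ¬ j ≤ k by omega])
    convert this using 1
    rw [Finset.sum_congr rfl (g := fun _ => (-1 : ℂ))]
    · have hj : ((j.toNat : ℤ) : ℂ) = j := by rw [Int.toNat_of_nonneg h]
      simp only [Finset.sum_const, Int.card_Ico, sub_zero, nsmul_eq_mul, mul_neg, mul_one]
      rw [← hj, Int.cast_natCast]
    · intro k hk
      simp only [Finset.mem_Ico] at hk
      simp [hk.1, show ¬ j ≤ k by omega]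
  · have := hasSum_sum_of_ne_finset_zero (L := SummationFilter.unconditional ℤ) (s := Finset.Ico j 0)
      (f := fun k : ℤ => (if j ≤ k then (1 : ℂ) else 0) - (if 0 ≤ k then 1 else 0)) (by
        intro k hk
        simp only [Finset.mem_Ico, not_and, not_lt] at hk
        by_cases h0 : j ≤ k
        · simp [h0, hk h0]
        · simp [h0, show ¬ 0 ≤ k by omega])
    convert this using 1
    rw [Finset.sum_congr rfl (g := fun _ => (1 : ℂ))]
    · have hj : (((-j).toNat : ℤ) : ℂ) = -j := by rw [Int.toNat_of_nonneg (by omega)]; simp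
      simp only [Finset.sum_const, Int.card_Ico, zero_sub, nsmul_eq_mul, mul_one]
      rw [← hj, Int.cast_natCast]
    · intro k hk
      simp only [Finset.mem_Ico] at hk
      simp [hk.1, show ¬ 0 ≤ k by omega]

lemma rf_step_norm_sum (j : ℤ) :
    HasSum (fun k : ℤ => ‖(if j ≤ k then (1 : ℂ) else 0) - (if 0 ≤ k then 1 else 0)‖) (|(j : ℝ)|) := by
  rcases le_total 0 j with h | h
  · have h1 := rf_step_sum j
    rw [← Complex.hasSum_ofReal]
    rw [abs_of_nonneg (by exact_mod_cast h)]
    refine rf_hcongr h1.neg (fun k => ?_) (by simp)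
    by_cases h0 : 0 ≤ k <;> by_cases h2 : j ≤ k <;> simp [h0, h2]
    omega
  · have h1 := rf_step_sum j
    rw [← Complex.hasSum_ofReal]
    rw [abs_of_nonpos (by exact_mod_cast h)]
    refine rf_hcongr h1 (fun k => ?_) (by simp)
    by_cases h0 : 0 ≤ k <;> by_cases h2 : j ≤ k <;> simp [h0, h2]
    omega

lemma rf_residue {G U : ℤ → ℂ} (κ : ℂ) (hU0 : HasSum U 0) (hU : Summable fun j => ‖U j‖)
    (hU1 : Summable fun j : ℤ => ‖(j : ℂ) * U j‖)
    (hH : Summable fun d : ℤ => ‖G d - if 0 ≤ d then κ else 0‖) :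
    HasSum (fun k : ℤ => ∑' j, G (k - j) * U j) (-κ * ∑' j : ℤ, (j : ℂ) * U j) := by
  have h1 := rf_conv (rf_prod hH hU) 1
  rw [hU0.tsum_eq, mul_zero] at h1
  -- the step part
  have hs : Summable (fun x : ℤ × ℤ =>
      ((if x.1 ≤ x.2 then (1 : ℂ) else 0) - (if 0 ≤ x.2 then 1 else 0)) * U x.1) := by
    apply Summable.of_norm
    rw [summable_prod_of_nonneg (fun _ => norm_nonneg _)]
    constructor
    · intro j
      simp only [norm_mul]
      exact (rf_step_norm_sum j).summable.mul_right _
    · simp only [norm_mul, tsum_mul_right, (rf_step_norm_sum _).tsum_eq]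
      refine hU1.congr fun j => ?_
      rw [norm_mul, ← Complex.ofReal_intCast, Complex.norm_real, Real.norm_eq_abs]
  have ht : HasSum (fun x : ℤ × ℤ =>
      ((if x.1 ≤ x.2 then (1 : ℂ) else 0) - (if 0 ≤ x.2 then 1 else 0)) * U x.1)
      (∑' j : ℤ, -(j : ℂ) * U j) := by
    have := hs.hasSum
    have h2 := this.prod_fiberwise fun j => (rf_step_sum j).mul_right (U j)
    rwa [← h2.tsum_eq] at this
  have ht2 : HasSum (fun x : ℤ × ℤ =>
      ((if x.2 ≤ x.1 then (1 : ℂ) else 0) - (if 0 ≤ x.1 then 1 else 0)) * U x.2)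
      (∑' j : ℤ, -(j : ℂ) * U j) := (Equiv.prodComm ℤ ℤ).hasSum_iff.mpr ht
  have ht3 := ht2.prod_fiberwise fun k => (ht2.summable.prod_factor k).hasSum
  have h4 := h1.add (ht3.mul_left κ)
  refine rf_hcongr h4 (fun k => ?_) ?_
  · have a1 : Summable (fun j : ℤ => (G (k - 1 * j) - if 0 ≤ k - 1 * j then κ else 0) * U j) := by
      have := summable_mul_of_summable_norm hH hU
      let e : ℤ × ℤ ≃ ℤ × ℤ :=
        { toFun := fun x => (x.1 - 1 * x.2, x.2)
          invFun := fun x => (x.1 + 1 * x.2, x.2)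
          left_inv := fun x => by simp
          right_inv := fun x => by simp }
      exact (e.summable_iff.mpr this).prod_factor k
    have a2 := ht2.summable.prod_factor k
    simp only at a2
    have a3 : HasSum (fun j : ℤ => κ * ((if 0 ≤ k then (1 : ℂ) else 0) * U j)) 0 := by
      simpa using (hU0.mul_left (if 0 ≤ k then (1 : ℂ) else 0)).mul_left κ
    have a4 := (a1.hasSum.add (((a2.mul_left κ).hasSum).add a3)).tsum_eq
    rw [tsum_mul_left, add_zero] at a4
    refine Eq.trans ?_ a4
    congr 1; ext j
    simp only [one_mul, sub_nonneg]
    split_ifs <;> ring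
  · rw [show (fun j : ℤ => -(j : ℂ) * U j) = fun j : ℤ => -((j : ℂ) * U j) by ext; ring, tsum_neg]
    ring

lemma rf_odd_only {f : ℤ → ℂ} {s : ℂ} (h : HasSum f s) (h0 : ∀ i, f (2 * i) = 0) :
    HasSum (fun i => f (2 * i + 1)) s := by
  have hi : Function.Injective (fun i : ℤ => 2 * i + 1) := fun a b h => by simpa using h
  refine (hi.hasSum_iff ?_).mpr h
  intro x hx
  rcases Int.even_or_odd' x with ⟨c, rfl | rfl⟩
  · exact h0 c
  · exact absurd ⟨c, rfl⟩ hx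

lemma rf_fib_summable {F : ℤ × ℤ → ℂ} (h : Summable F) (l k : ℤ) :
    Summable (fun j : ℤ => F (k - l * j, j)) := by
  let e : ℤ × ℤ ≃ ℤ × ℤ :=
    { toFun := fun x => (x.1 - l * x.2, x.2)
      invFun := fun x => (x.1 + l * x.2, x.2)
      left_inv := fun x => by simp
      right_inv := fun x => by simp }
  exact (e.summable_iff.mpr h).prod_factor k

lemma rf_conv_summable {g D : ℤ → ℂ} (hg : ∀ k : ℕ, Summable fun d : ℤ => ‖(d : ℂ) ^ k * g d‖)
    (hD : ∀ k : ℕ, Summable fun d : ℤ => ‖(d : ℂ) ^ k * D d‖) (l k : ℤ) :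
    Summable (fun j : ℤ => g (k - l * j) * D j) := by
  have h1 := hg 0
  have h2 := hD 0
  simp only [pow_zero, one_mul] at h1 h2
  exact rf_fib_summable (rf_prod h1 h2).summable l k

lemma rf_conv_neg {g D : ℤ → ℂ} (l : ℤ) (go : ∀ d, g (-d) = -g d) (De : ∀ d, D (-d) = D d) (k : ℤ) :
    ∑' j, g (-k - l * j) * D j = -∑' j, g (k - l * j) * D j := by
  rw [← (Equiv.neg ℤ).tsum_eq, ← tsum_neg]
  congr 1; ext j
  simp only [Equiv.neg_apply, De]
  rw [show -k - l * -j = -(k - l * j) by ring, go]; ring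

lemma rf_lower {r : ℝ} {x : ℂ} (hx : ‖x‖ ≤ r) : 1 - r ≤ ‖1 + x‖ := by
  have := norm_sub_norm_le (1 : ℂ) (-x)
  simp only [norm_one, norm_neg, sub_neg_eq_add] at this
  linarith

lemma rf_quot {r : ℝ} {x y : ℂ} {B : ℝ} (hr1 : r < 1) (hx : ‖x‖ ≤ r) (hy : ‖y‖ ≤ B) :
    ‖y / (1 + x)‖ ≤ B / (1 - r) := by
  rw [norm_div]
  have := rf_lower hx
  exact div_le_div₀ ((norm_nonneg _).trans hy) hy (by linarith) this

lemma rf_geo_odd {g : ℤ → ℂ} {C r : ℝ} (hr0 : 0 ≤ r) (hr : r < 1) (go : ∀ d, g (-d) = -g d)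
    (h : ∀ n : ℕ, ‖g n‖ ≤ C * r ^ n) (k : ℕ) :
    Summable fun d : ℤ => ‖(d : ℂ) ^ k * g d‖ := by
  refine rf_geo hr0 hr (C := C) (fun d => ?_) k
  rcases Int.natAbs_eq d with e | e
  · conv_lhs => rw [e]
    exact h _
  · conv_lhs => rw [e]
    rw [go, norm_neg]
    exact h _

noncomputable def rfg1 (q : ℂ) (d : ℤ) : ℂ := q ^ d * (1 - q ^ (2 * d)) / (1 + q ^ (4 * d))
noncomputable def rfg2 (q : ℂ) (d : ℤ) : ℂ := (ZMod.χ₈ (d : ZMod 8) : ℂ) * (q ^ d / (1 - q ^ (2 * d)))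

lemma rf_zp {q : ℂ} (d : ℤ) (m : ℤ) : q ^ (m * d) = (q ^ d) ^ m := by
  rw [mul_comm, zpow_mul]

lemma rfg1_odd {q : ℂ} (hq : q ≠ 0) (d : ℤ) : rfg1 q (-d) = -rfg1 q d := by
  unfold rfg1
  rw [rf_zp, rf_zp, rf_zp, rf_zp, zpow_neg]
  have hx : q ^ d ≠ 0 := zpow_ne_zero _ hq
  generalize q ^ d = x at *
  norm_cast
  by_cases h : 1 + x ^ 4 = 0
  · have : 1 + x⁻¹ ^ 4 = 0 := by field_simp; linear_combination h
    rw [h, this]; simp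
  · have : 1 + x⁻¹ ^ 4 = (1 + x ^ 4) / x ^ 4 := by field_simp; ring
    rw [this]; field_simp; ring

lemma rfg2_odd {q : ℂ} (hq : q ≠ 0) (d : ℤ) : rfg2 q (-d) = -rfg2 q d := by
  unfold rfg2
  have hc : ∀ a : ZMod 8, ZMod.χ₈ (-a) = ZMod.χ₈ a := by decide
  rw [Int.cast_neg, hc, rf_zp, rf_zp, zpow_neg]
  have hx : q ^ d ≠ 0 := zpow_ne_zero _ hq
  generalize q ^ d = x at *
  norm_cast
  by_cases h : 1 - x ^ 2 = 0
  · have : 1 - x⁻¹ ^ 2 = 0 := by field_simp; linear_combination -h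
    rw [h, this]; simp
  · have : 1 - x⁻¹ ^ 2 = -(1 - x ^ 2) / x ^ 2 := by field_simp; ring
    rw [this]; field_simp

lemma rf_pow_le {q : ℂ} (hq1 : ‖q‖ < 1) {m n : ℕ} (h : m ≤ n) : ‖q ^ n‖ ≤ ‖q‖ ^ m := by
  rw [norm_pow]; exact pow_le_pow_of_le_one (norm_nonneg _) hq1.le h

lemma rf_pow_le1 {q : ℂ} (hq1 : ‖q‖ < 1) {n : ℕ} (h : n ≠ 0) : ‖q ^ n‖ ≤ ‖q‖ := by
  simpa using rf_pow_le hq1 (m := 1) (n := n) (by omega)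

lemma rfg1_sum {q : ℂ} (hq : q ≠ 0) (hq1 : ‖q‖ < 1) (k : ℕ) :
    Summable fun d : ℤ => ‖(d : ℂ) ^ k * rfg1 q d‖ := by
  refine rf_geo_odd (norm_nonneg q) hq1 (C := 2 / (1 - ‖q‖)) (rfg1_odd hq) (fun n => ?_) k
  have h1 : 0 < 1 - ‖q‖ := by linarith
  rcases Nat.eq_zero_or_pos n with rfl | hn
  · simp [rfg1]; positivity
  · unfold rfg1
    rw [div_mul_eq_mul_div]
    norm_cast
    refine rf_quot hq1 (rf_pow_le1 hq1 (by omega)) ?_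
    rw [norm_mul, norm_pow, mul_comm]
    gcongr
    calc _ ≤ ‖(1 : ℂ)‖ + ‖q ^ (2 * n)‖ := norm_sub_le _ _
      _ ≤ 1 + 1 := by
        gcongr
        · simp
        · exact (rf_pow_le1 hq1 (by omega)).trans hq1.le
      _ = 2 := by norm_num

lemma rf_chi_le (a : ZMod 8) : ‖(ZMod.χ₈ a : ℂ)‖ ≤ 1 := by
  have : ∀ a : ZMod 8, |ZMod.χ₈ a| ≤ 1 := by decide
  rw [← Complex.ofReal_intCast, Complex.norm_real, Real.norm_eq_abs]
  exact_mod_cast this a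

lemma rfg2_sum {q : ℂ} (hq : q ≠ 0) (hq1 : ‖q‖ < 1) (k : ℕ) :
    Summable fun d : ℤ => ‖(d : ℂ) ^ k * rfg2 q d‖ := by
  refine rf_geo_odd (norm_nonneg q) hq1 (C := 1 / (1 - ‖q‖)) (rfg2_odd hq) (fun n => ?_) k
  have h1 : 0 < 1 - ‖q‖ := by linarith
  rcases Nat.eq_zero_or_pos n with rfl | hn
  · simp [rfg2]; exact hq1.le
  · unfold rfg2
    rw [div_mul_eq_mul_div, norm_mul]
    rw [← one_mul (1 * ‖q‖ ^ n / (1 - ‖q‖))]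
    refine mul_le_mul (rf_chi_le _) ?_ (norm_nonneg _) zero_le_one
    norm_cast
    rw [sub_eq_add_neg]
    refine rf_quot hq1 ?_ ?_
    · rw [norm_neg]; exact (rf_pow_le1 hq1 (by omega))
    · simp

lemma rfD_sum {q y : ℂ} (hq : q ≠ 0) (hq1 : ‖q‖ < 1) (hy : y ≠ 0) (k : ℕ) :
    Summable fun d : ℤ => ‖(d : ℂ) ^ k * (q ^ (d ^ 2) * y ^ d)‖ := rf_gsum hq hq1 hy k

lemma rf_n1pow_neg (d : ℤ) : (-1 : ℂ) ^ (-d) = (-1) ^ d := by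
  rw [zpow_neg, ← inv_zpow]; norm_num

lemma rf_n1pow_sq (d : ℤ) : (-1 : ℂ) ^ d * (-1) ^ d = 1 := by
  rw [← mul_zpow]; norm_num

noncomputable def rfn1 (q : ℂ) (k : ℤ) : ℂ := ∑' j : ℤ, rfg1 q (k - 1 * j) * (q ^ (j ^ 2) * (-1) ^ j)
noncomputable def rfn2 (q : ℂ) (k : ℤ) : ℂ := ∑' j : ℤ, rfg2 q (k - 4 * j) * ((q ^ 4) ^ (j ^ 2) * 1 ^ j)

lemma rfn1_neg {q : ℂ} (hq : q ≠ 0) (k : ℤ) : rfn1 q (-k) = -rfn1 q k :=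
  rf_conv_neg 1 (rfg1_odd hq) (fun d => by rw [neg_sq, rf_n1pow_neg]) k

lemma rfn2_neg {q : ℂ} (hq : q ≠ 0) (k : ℤ) : rfn2 q (-k) = -rfn2 q k :=
  rf_conv_neg 4 (rfg2_odd hq) (fun d => by simp) k

lemma rf_den1 {q : ℂ} (hq : q ≠ 0) (hq1 : ‖q‖ < 1) (d : ℤ) : 1 + q ^ (4 * d) ≠ 0 := by
  intro h
  have h2 : ‖q ^ (4 * d)‖ = 1 := by
    rw [show q ^ (4 * d) = -1 by linear_combination h]; simp
  have hn : 0 < ‖q‖ := norm_pos_iff.mpr hq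
  rw [norm_zpow] at h2
  rcases eq_or_ne d 0 with rfl | hd
  · norm_num at h
  · rw [zpow_eq_one_iff_right₀ hn.le hq1.ne] at h2
    omega

lemma rf_den2 {q : ℂ} (hq : q ≠ 0) (hq1 : ‖q‖ < 1) {d : ℤ} (hd : d ≠ 0) : 1 - q ^ d ≠ 0 := by
  intro h
  have h2 : ‖q ^ d‖ = 1 := by
    rw [show q ^ d = 1 by linear_combination -h]; simp
  have hn : 0 < ‖q‖ := norm_pos_iff.mpr hq
  rw [norm_zpow, zpow_eq_one_iff_right₀ hn.le hq1.ne] at h2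
  exact hd h2

lemma rfn1_rec {q : ℂ} (hq : q ≠ 0) (hq1 : ‖q‖ < 1) (k : ℤ) :
    rfn1 q (k + 2) = -q ^ (4 * k + 4) * rfn1 q k := by
  have hs := fun k => (rf_conv_summable (rfg1_sum hq hq1) (rfD_sum hq hq1 (y := -1) (by norm_num)) 1 k).hasSum
  have h1 := rf_shift (hs (k + 2)) 2
  have h2 := h1.add ((hs k).mul_left (q ^ (4 * k + 4)))
  have v3 := (rf_vanish hq hq1 3 (by decide)).mul_left (q ^ (k + 4))
  have v1 := (rf_vanish hq hq1 1 (by decide)).mul_left (q ^ (3 * k + 4))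
  have v := v3.sub v1
  have h3 := h2.unique (rf_hcongr v (fun j => ?_) rfl)
  · unfold rfn1; linear_combination h3
  · have e1 : k + 2 - 1 * (j + 2) = k - j := by ring
    rw [e1, one_mul]
    have hden := rf_den1 hq hq1 (k - j)
    have hg : rfg1 q (k - j) * (1 + q ^ (4 * (k - j))) = q ^ (k - j) * (1 - q ^ (2 * (k - j))) := by
      unfold rfg1; field_simp
    have n2 : (-1 : ℂ) ^ (j + 2) = (-1) ^ j := by rw [zpow_add₀ (by norm_num)]; norm_num
    rw [n2, neg_eq_neg_one_mul (q ^ (3 : ℤ)), neg_eq_neg_one_mul (q ^ (1 : ℤ)), mul_zpow, mul_zpow,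
      ← zpow_mul, ← zpow_mul]
    have f1 : q ^ ((j + 2) ^ 2) = q ^ (j ^ 2) * q ^ (4 * j + 4) := by
      rw [← zpow_add₀ hq]; congr 1; ring
    have f2 : q ^ (4 * k + 4) = q ^ (4 * j + 4) * q ^ (4 * (k - j)) := by
      rw [← zpow_add₀ hq]; congr 1; ring
    have f3 : q ^ (k + 4) * q ^ (3 * j) = q ^ (4 * j + 4) * q ^ (k - j) := by
      rw [← zpow_add₀ hq, ← zpow_add₀ hq]; congr 1; ring
    have f4 : q ^ (3 * k + 4) * q ^ (1 * j) = q ^ (4 * j + 4) * (q ^ (k - j) * q ^ (2 * (k - j))) := by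
      rw [← zpow_add₀ hq, ← zpow_add₀ hq, ← zpow_add₀ hq]; congr 1; ring
    rw [f1, f2]
    linear_combination (q ^ (j ^ 2) * (-1) ^ j * q ^ (4 * j + 4)) * hg -
      q ^ (j ^ 2) * (-1) ^ j * f3 + q ^ (j ^ 2) * (-1) ^ j * f4

lemma rf_chi_shift (k j : ℤ) : (ZMod.χ₈ ((k - 4 * j : ℤ) : ZMod 8) : ℂ) =
    (ZMod.χ₈ (k : ZMod 8) : ℂ) * (-1) ^ j := by
  have hc : ∀ a b : ZMod 8, ZMod.χ₈ (a - 4 * (2 * b)) = ZMod.χ₈ a ∧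
    ZMod.χ₈ (a - 4 * (2 * b + 1)) = -ZMod.χ₈ a := by decide
  rcases Int.even_or_odd' j with ⟨i, rfl | rfl⟩
  · have := (hc k i).1
    push_cast
    rw [this, zpow_mul]; norm_num
  · have := (hc k i).2
    push_cast
    rw [this, zpow_add₀ (by norm_num), zpow_mul]; norm_num

lemma rfn2_rec {q : ℂ} (hq : q ≠ 0) (hq1 : ‖q‖ < 1) (k : ℤ) :
    rfn2 q (k + 4) = q ^ (2 * k + 4) * rfn2 q k := by
  have hq4 : q ^ 4 ≠ 0 := pow_ne_zero _ hq
  have hq41 : ‖q ^ 4‖ < 1 := by rw [norm_pow]; exact pow_lt_one₀ (norm_nonneg _) hq1 (by norm_num)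
  have hs := fun k => (rf_conv_summable (rfg2_sum hq hq1) (rfD_sum hq4 hq41 (y := 1) (by norm_num)) 4 k).hasSum
  have h1 := rf_shift (hs (k + 4)) 1
  have h2 := h1.sub ((hs k).mul_left (q ^ (2 * k + 4)))
  have v := (rf_vanish hq4 hq41 1 (by decide)).mul_left (ZMod.χ₈ (k : ZMod 8) * q ^ (k + 4))
  have h3 := h2.unique (rf_hcongr v (fun j => ?_) rfl)
  · unfold rfn2; linear_combination h3
  · simp only [one_zpow, mul_one]
    have e1 : k + 4 - 4 * (j + 1) = k - 4 * j := by ring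
    rw [e1]
    have hg : rfg2 q (k - 4 * j) * (1 - q ^ (2 * (k - 4 * j))) =
        ZMod.χ₈ (k : ZMod 8) * (-1) ^ j * q ^ (k - 4 * j) := by
      rw [← rf_chi_shift]
      unfold rfg2
      rcases eq_or_ne (k - 4 * j) 0 with h | h
      · rw [h]; simp
      · have := rf_den2 hq hq1 (d := 2 * (k - 4 * j)) (by omega)
        field_simp
    rw [neg_eq_neg_one_mul ((q ^ 4) ^ (1 : ℤ)), mul_zpow]
    have e4 : q ^ 4 = q ^ (4 : ℤ) := by norm_cast
    rw [e4]
    simp only [← zpow_mul]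
    have f1 : q ^ (4 * (j + 1) ^ 2) = q ^ (4 * j ^ 2) * q ^ (8 * j + 4) := by
      rw [← zpow_add₀ hq]; congr 1; ring
    have f2 : q ^ (2 * k + 4) = q ^ (8 * j + 4) * q ^ (2 * (k - 4 * j)) := by
      rw [← zpow_add₀ hq]; congr 1; ring
    have f3 : q ^ (k + 4) * q ^ (4 * 1 * j) = q ^ (8 * j + 4) * q ^ (k - 4 * j) := by
      rw [← zpow_add₀ hq, ← zpow_add₀ hq]; congr 1; ring
    rw [f1, f2]
    linear_combination (q ^ (4 * j ^ 2) * q ^ (8 * j + 4)) * hg -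
      q ^ (4 * j ^ 2) * (-1) ^ j * ZMod.χ₈ (k : ZMod 8) * f3

lemma rfn1_even {q : ℂ} (hq : q ≠ 0) (hq1 : ‖q‖ < 1) (i : ℤ) : rfn1 q (2 * i) = 0 := by
  induction i using Int.induction_on with
  | zero =>
    have := rfn1_neg hq 0
    simp only [neg_zero, mul_zero] at this ⊢
    linear_combination (1 / 2) * this
  | succ i ih =>
    have := rfn1_rec hq hq1 (2 * i)
    rw [ih] at this
    rw [show (2 * ((i : ℤ) + 1)) = 2 * i + 2 by ring, this, mul_zero]
  | pred i ih =>
    have := rfn1_rec hq hq1 (2 * (-i - 1))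
    rw [show 2 * (-(i : ℤ) - 1) + 2 = 2 * -i by ring, ih] at this
    have h0 : q ^ (4 * (2 * (-(i : ℤ) - 1)) + 4) ≠ 0 := zpow_ne_zero _ hq
    simpa [h0] using this.symm

lemma rfn1_oddv {q : ℂ} (hq : q ≠ 0) (hq1 : ‖q‖ < 1) (i : ℤ) :
    rfn1 q (2 * i + 1) = (-1) ^ i * q ^ (4 * i ^ 2 + 4 * i) * rfn1 q 1 := by
  have key : ∀ i : ℤ, q ^ (4 * (i + 1) ^ 2 + 4 * (i + 1)) =
      q ^ (4 * (2 * i + 1) + 4) * q ^ (4 * i ^ 2 + 4 * i) := fun i => by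
    rw [← zpow_add₀ hq]; congr 1; ring
  have key2 : ∀ i : ℤ, (-1 : ℂ) ^ (i + 1) = -(-1) ^ i := fun i => by
    rw [zpow_add₀ (by norm_num)]; norm_num
  induction i using Int.induction_on with
  | zero => simp
  | succ i ih =>
    have := rfn1_rec hq hq1 (2 * i + 1)
    rw [ih] at this
    rw [show (2 * ((i : ℤ) + 1) + 1) = 2 * i + 1 + 2 by ring, this, key, key2]; ring
  | pred i ih =>
    have := rfn1_rec hq hq1 (2 * (-i - 1) + 1)
    have k1 := key (-i - 1)
    have k2 := key2 (-i - 1)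
    rw [sub_add_cancel] at k1 k2
    rw [show 2 * (-(i : ℤ) - 1) + 1 + 2 = 2 * -i + 1 by ring, ih, k1, k2] at this
    have h0 : q ^ (4 * (2 * (-(i : ℤ) - 1) + 1) + 4) ≠ 0 := zpow_ne_zero _ hq
    apply mul_left_cancel₀ h0
    linear_combination this

lemma rfn2_even {q : ℂ} (i : ℤ) : rfn2 q (2 * i) = 0 := by
  unfold rfn2
  have : ∀ j : ℤ, rfg2 q (2 * i - 4 * j) = 0 := fun j => by
    have hc : ∀ a : ZMod 8, ZMod.χ₈ (2 * a) = 0 := by decide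
    unfold rfg2
    rw [show 2 * i - 4 * j = 2 * (i - 2 * j) by ring]
    push_cast
    have := hc (i - 2 * j)
    rw [this]; simp
  simp [this]

lemma rfn2_oddv {q : ℂ} (hq : q ≠ 0) (hq1 : ‖q‖ < 1) (i : ℤ) :
    rfn2 q (2 * i + 1) = (-1) ^ i * q ^ (i ^ 2 + i) * rfn2 q 1 := by
  have key : ∀ i : ℤ, q ^ ((i + 1) ^ 2 + (i + 1)) =
      q ^ (2 * (2 * (i - 1) + 1) + 4) * q ^ ((i - 1) ^ 2 + (i - 1)) := fun i => by
    rw [← zpow_add₀ hq]; congr 1; ring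
  have key2 : ∀ i : ℤ, (-1 : ℂ) ^ (i + 1) = (-1) ^ (i - 1) := fun i => by
    rw [zpow_add₀ (by norm_num), zpow_sub₀ (by norm_num), div_eq_mul_inv]; norm_num
  suffices (rfn2 q (2 * i + 1) = (-1) ^ i * q ^ (i ^ 2 + i) * rfn2 q 1) ∧
    (rfn2 q (2 * (i - 1) + 1) = (-1) ^ (i - 1) * q ^ ((i - 1) ^ 2 + (i - 1)) * rfn2 q 1) from this.1
  induction i using Int.induction_on with
  | zero =>
    refine ⟨by simp, ?_⟩
    have := rfn2_neg hq 1
    norm_num [this]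
  | succ i ih =>
    refine ⟨?_, by rw [add_sub_cancel_right]; exact ih.1⟩
    have := rfn2_rec hq hq1 (2 * ((i : ℤ) - 1) + 1)
    rw [ih.2] at this
    rw [show (2 * ((i : ℤ) + 1) + 1) = 2 * (i - 1) + 1 + 4 by ring, this, key, key2]; ring
  | pred i ih =>
    refine ⟨ih.2, ?_⟩
    have := rfn2_rec hq hq1 (2 * (-(i : ℤ) - 1 - 1) + 1)
    have k1 := key (-(i : ℤ) - 1)
    have k2 := key2 (-(i : ℤ) - 1)
    rw [sub_add_cancel] at k1 k2
    rw [show 2 * (-(i : ℤ) - 1 - 1) + 1 + 4 = 2 * -i + 1 by ring, ih.1, k1, k2] at this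
    have h0 : q ^ (2 * (2 * (-(i : ℤ) - 1 - 1) + 1) + 4) ≠ 0 := zpow_ne_zero _ hq
    apply mul_left_cancel₀ h0
    linear_combination -this

lemma rf_inv_neg_one_zpow (q : ℂ) (j : ℤ) : (-q⁻¹) ^ j = (-1) ^ j * q ^ (-j) := by
  rw [neg_eq_neg_one_mul, mul_zpow, inv_zpow, zpow_neg]

lemma rf_neg_zpow (q : ℂ) (j : ℤ) : (-q) ^ j = (-1) ^ j * q ^ j := by
  rw [neg_eq_neg_one_mul, mul_zpow]

lemma rf_pz (q : ℂ) (m : ℕ) (j : ℤ) : (q ^ m) ^ j = q ^ ((m : ℤ) * j) := by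
  rw [zpow_mul, zpow_natCast]

theorem rf_case1 {q : ℂ} (hq : q ≠ 0) (hq1 : ‖q‖ < 1) :
    (rfn1 q 1) * rfJ 1 (q ^ 4) = (∑' d : ℤ, (d : ℂ) * rfg1 q d) * rfTh 0 q (-1) ∧
    (rfn1 q 1) * rfJ 3 (q ^ 4) = (∑' d : ℤ, (d : ℂ) ^ 3 * rfg1 q d) * rfTh 0 q (-1) +
      3 * (∑' d : ℤ, (d : ℂ) * rfg1 q d) * rfTh 2 q (-1) ∧
    (rfn1 q 1) * rfTh 0 (q ^ 4) (-q ^ 2) = q * rfP (q ^ 2) ^ 3 := by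
  have M := rf_moment 1 (rfg1_sum hq hq1) (rfD_sum hq hq1 (y := -1) (by norm_num)) (rfg1_odd hq)
    (fun d => by rw [neg_sq, rf_n1pow_neg])
  have hterm : ∀ i : ℤ, (q ^ 4) ^ (i ^ 2) * (-q ^ 4) ^ i = (-1) ^ i * q ^ (4 * i ^ 2 + 4 * i) := fun i => by
    rw [rf_neg_zpow, rf_pz, rf_pz, zpow_add₀ hq]; push_cast; ring
  have ev : ∀ i, rfn1 q (2 * i) = 0 := rfn1_even hq hq1
  refine ⟨?_, ?_, ?_⟩
  · have h := rf_odd_only M.1 (fun i => by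
      have := ev i
      unfold rfn1 at this
      rw [this, mul_zero])
    have h2 := h.tsum_eq
    rw [rfTh]
    simp only [pow_zero, one_mul] at h2 ⊢
    rw [← h2, rfJ, ← tsum_mul_left]
    congr 1; ext i
    have := rfn1_oddv hq hq1 i
    unfold rfn1 at this ⊢
    simp only [one_mul] at this ⊢
    rw [this, hterm]; ring
  · have h := rf_odd_only M.2 (fun i => by
      have := ev i
      unfold rfn1 at this
      rw [this, mul_zero])
    have h2 := h.tsum_eq
    rw [rfTh, rfTh]
    simp only [pow_zero, one_mul, Int.cast_one, one_pow, mul_one] at h2 ⊢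
    rw [← h2, rfJ, ← tsum_mul_left]
    congr 1; ext i
    have := rfn1_oddv hq hq1 i
    unfold rfn1 at this ⊢
    simp only [one_mul] at this ⊢
    rw [this, hterm]; ring
  · have hU0 := rf_vanish hq hq1 (-1) (by decide)
    rw [zpow_neg_one] at hU0
    have hy : -q⁻¹ ≠ 0 := neg_ne_zero.mpr (inv_ne_zero hq)
    have hU1 := rf_gsum hq hq1 hy 1
    simp only [pow_one] at hU1
    have hH : Summable fun d : ℤ => ‖rfg1 q d * q ^ (-d) - if 0 ≤ d then (1 : ℂ) else 0‖ := by
      have : ∀ d : ℤ, rfg1 q d * q ^ (-d) = (1 - q ^ (2 * d)) / (1 + q ^ (4 * d)) := fun d => by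
        unfold rfg1
        rw [zpow_neg]
        have := zpow_ne_zero d hq
        field_simp
      have h0 : 0 < 1 - ‖q‖ := by linarith
      have := rf_geo (g := fun d : ℤ => rfg1 q d * q ^ (-d) - if 0 ≤ d then (1 : ℂ) else 0)
        (norm_nonneg q) hq1 (C := 2 / (1 - ‖q‖)) (fun d => ?_) 0
      · simpa using this
      · simp only [this]
        rw [div_mul_eq_mul_div]
        rcases Int.natAbs_eq d with e | e
        · set n := d.natAbs with hn
          rw [e]
          simp only [Nat.cast_nonneg, if_true]
          have hd := rf_den1 hq hq1 n
          rw [show (1 - q ^ (2 * (n : ℤ))) / (1 + q ^ (4 * (n : ℤ))) - 1 =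
            (-q ^ (2 * (n : ℤ)) - q ^ (4 * (n : ℤ))) / (1 + q ^ (4 * (n : ℤ))) by field_simp; ring]
          norm_cast
          rcases Nat.eq_zero_or_pos n with h | h
          · rw [h]
            norm_num
            rw [le_div_iff₀ h0]; linarith [norm_nonneg q]
          · refine rf_quot hq1 (rf_pow_le1 hq1 (by omega)) ?_
            refine (norm_sub_le _ _).trans ?_
            rw [norm_neg, two_mul (‖q‖ ^ n)]
            exact add_le_add (rf_pow_le hq1 (m := n) (n := 2 * n) (by omega)) (rf_pow_le hq1 (m := n) (n := 4 * n) (by omega))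
        · set n := d.natAbs with hn
          rcases Nat.eq_zero_or_pos n with h | h
          · rw [e, h]
            norm_num
            rw [le_div_iff₀ h0]; linarith [norm_nonneg q]
          · rw [e, if_neg (by omega), sub_zero]
            have hd := rf_den1 hq hq1 n
            have : (1 - q ^ (2 * -(n : ℤ))) / (1 + q ^ (4 * -(n : ℤ))) =
              (q ^ (4 * (n : ℤ)) - q ^ (2 * (n : ℤ))) / (1 + q ^ (4 * (n : ℤ))) := by
              have hd2 := rf_den1 hq hq1 (-n)
              rw [div_eq_div_iff hd2 hd]
              have e1 : q ^ (4 * -(n : ℤ)) * q ^ (4 * (n : ℤ)) = 1 := by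
                rw [← zpow_add₀ hq]; simp
              have e2 : q ^ (4 * (n : ℤ)) * q ^ (2 * -(n : ℤ)) = q ^ (2 * (n : ℤ)) := by
                rw [← zpow_add₀ hq]; congr 1; ring
              have e3 : q ^ (4 * -(n : ℤ)) * q ^ (2 * (n : ℤ)) = q ^ (2 * -(n : ℤ)) := by
                rw [← zpow_add₀ hq]; congr 1; ring
              linear_combination -e1 - e2 + e3
            rw [this]
            norm_cast
            refine rf_quot hq1 (rf_pow_le1 hq1 (by omega)) ?_
            refine (norm_sub_le _ _).trans ?_
            rw [two_mul (‖q‖ ^ n)]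
            exact add_le_add (rf_pow_le hq1 (m := n) (n := 4 * n) (by omega)) (rf_pow_le hq1 (m := n) (n := 2 * n) (by omega))
    have R := rf_residue 1 hU0 (rf_gsum0 hq hq1 hy) hU1 hH
    rw [rf_jacobi hq hq1] at R
    have R2 : HasSum (fun k : ℤ => q ^ (-k) * rfn1 q k) (rfP (q ^ 2) ^ 3) := by
      refine rf_hcongr R (fun k => ?_) (by ring)
      unfold rfn1
      rw [← tsum_mul_left]
      congr 1; ext j
      rw [rf_inv_neg_one_zpow, one_mul]
      have : q ^ (-k) = q ^ (-(k - j)) * q ^ (-j) := by rw [← zpow_add₀ hq]; congr 1; ring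
      rw [this]; ring
    have h := (rf_odd_only R2 (fun i => by rw [ev i, mul_zero])).tsum_eq
    rw [← h, rfTh, ← tsum_mul_left, ← tsum_mul_left]
    congr 1; ext i
    rw [rfn1_oddv hq hq1, rf_neg_zpow, rf_pz, rf_pz, pow_zero]
    push_cast
    have : q ^ (4 * i ^ 2) * q ^ (2 * i) = q * (q ^ (-(2 * i + 1)) * q ^ (4 * i ^ 2 + 4 * i)) := by
      nth_rewrite 3 [← zpow_one q]
      rw [← zpow_add₀ hq, ← zpow_add₀ hq, ← zpow_add₀ hq]; congr 1; ring
    linear_combination rfn1 q 1 * (-1) ^ i * this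

theorem rf_case2 {q : ℂ} (hq : q ≠ 0) (hq1 : ‖q‖ < 1) :
    (rfn2 q 1) * rfJ 1 q = (∑' d : ℤ, (d : ℂ) * rfg2 q d) * rfTh 0 (q ^ 4) 1 ∧
    (rfn2 q 1) * rfJ 3 q = (∑' d : ℤ, (d : ℂ) ^ 3 * rfg2 q d) * rfTh 0 (q ^ 4) 1 +
      48 * (∑' d : ℤ, (d : ℂ) * rfg2 q d) * rfTh 2 (q ^ 4) 1 ∧
    (rfn2 q 1) * rfTh 0 (q ^ 4) (-q ^ 2) = q * rfP (q ^ 8) ^ 3 := by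
  have hq4 : q ^ 4 ≠ 0 := pow_ne_zero _ hq
  have hq41 : ‖q ^ 4‖ < 1 := by rw [norm_pow]; exact pow_lt_one₀ (norm_nonneg _) hq1 (by norm_num)
  have M := rf_moment 4 (rfg2_sum hq hq1) (rfD_sum hq4 hq41 (y := 1) (by norm_num)) (rfg2_odd hq)
    (fun d => by simp)
  have hterm : ∀ i : ℤ, q ^ (i ^ 2) * (-q) ^ i = (-1) ^ i * q ^ (i ^ 2 + i) := fun i => by
    rw [rf_neg_zpow, zpow_add₀ hq]; ring
  have ev : ∀ i, rfn2 q (2 * i) = 0 := rfn2_even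
  refine ⟨?_, ?_, ?_⟩
  · have h := rf_odd_only M.1 (fun i => by
      have := ev i
      unfold rfn2 at this
      rw [this, mul_zero])
    have h2 := h.tsum_eq
    rw [rfTh]
    simp only [pow_zero, one_mul] at h2 ⊢
    rw [← h2, rfJ, ← tsum_mul_left]
    congr 1; ext i
    have := rfn2_oddv hq hq1 i
    unfold rfn2 at this ⊢
    rw [this, hterm]; ring
  · have h := rf_odd_only M.2 (fun i => by
      have := ev i
      unfold rfn2 at this
      rw [this, mul_zero])
    have h2 := h.tsum_eq
    rw [rfTh, rfTh]
    simp only [pow_zero, one_mul] at h2 ⊢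
    rw [show (48 : ℂ) = 3 * ((4 : ℤ) : ℂ) ^ 2 by norm_num]
    rw [← h2, rfJ, ← tsum_mul_left]
    congr 1; ext i
    have := rfn2_oddv hq hq1 i
    unfold rfn2 at this ⊢
    rw [this, hterm]; ring
  · have hU0 := rf_vanish hq4 hq41 (-1) (by decide)
    rw [zpow_neg_one] at hU0
    have hy : -(q ^ 4)⁻¹ ≠ 0 := neg_ne_zero.mpr (inv_ne_zero hq4)
    have hU1 := rf_gsum hq4 hq41 hy 1
    simp only [pow_one] at hU1
    have hH : Summable fun d : ℤ => ‖q / (1 - q ^ (8 * d + 2)) - if 0 ≤ d then q else 0‖ := by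
      have h0 : 0 < 1 - ‖q‖ := by linarith
      have := rf_geo (g := fun d : ℤ => q / (1 - q ^ (8 * d + 2)) - if 0 ≤ d then q else 0)
        (norm_nonneg q) hq1 (C := 1 / (1 - ‖q‖)) (fun d => ?_) 0
      · simpa using this
      · rw [div_mul_eq_mul_div, one_mul]
        rcases lt_or_ge d 0 with hd | hd
        · obtain ⟨n, rfl⟩ : ∃ n : ℕ, d = -(n + 1) := ⟨(-d - 1).toNat, by omega⟩
          rw [if_neg (by omega), sub_zero, Int.natAbs_neg, show ((n : ℤ) + 1).natAbs = n + 1 by omega]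
          have hd : 1 - q ^ (8 * n + 6) ≠ 0 := rf_one_sub_ne hq1 (by omega)
          have e1 : q ^ (8 * -((n : ℤ) + 1) + 2) = (q ^ (8 * n + 6))⁻¹ := by
            rw [← zpow_natCast, ← zpow_neg]; congr 1
          have h9 : q ^ (8 * n + 6) ≠ 0 := pow_ne_zero _ hq
          have : q / (1 - (q ^ (8 * n + 6))⁻¹) = (-q ^ (8 * n + 7)) / (1 + -q ^ (8 * n + 6)) := by
            rw [show 1 - (q ^ (8 * n + 6))⁻¹ = -(1 + -q ^ (8 * n + 6)) / q ^ (8 * n + 6) by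
              field_simp; ring]
            rw [← sub_eq_add_neg]
            rw [pow_succ q (8 * n + 6)]
            generalize q ^ (8 * n + 6) = x at *
            field_simp
          rw [e1, this]
          refine rf_quot hq1 ?_ ?_
          · rw [norm_neg]; exact rf_pow_le1 hq1 (by omega)
          · rw [norm_neg]; exact rf_pow_le hq1 (m := n + 1) (by omega)
        · obtain ⟨n, rfl⟩ : ∃ n : ℕ, d = n := ⟨d.toNat, by omega⟩
          rw [if_pos hd]
          norm_cast
          have hd : 1 - q ^ (8 * n + 2) ≠ 0 := rf_one_sub_ne hq1 (by omega)
          rw [show q / (1 - q ^ (8 * n + 2)) - q = q ^ (8 * n + 3) / (1 + -q ^ (8 * n + 2)) by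
            rw [← sub_eq_add_neg]; field_simp; ring]
          refine rf_quot hq1 ?_ ?_
          · rw [norm_neg]; exact rf_pow_le1 hq1 (by omega)
          · exact rf_pow_le hq1 (m := n) (by omega)
    have R := rf_residue q hU0 (rf_gsum0 hq4 hq41 hy) hU1 hH
    rw [rf_jacobi hq4 hq41] at R
    have R2 : HasSum (fun k : ℤ => (-1) ^ k * q ^ (-(4 * k)) * rfn2 q (4 * k + 1)) (q * rfP (q ^ 8) ^ 3) := by
      refine rf_hcongr R (fun k => ?_) (by rw [← pow_mul]; norm_num)
      unfold rfn2
      rw [← tsum_mul_left]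
      congr 1; ext j
      rw [rf_inv_neg_one_zpow, rf_pz, rf_pz, one_zpow]
      unfold rfg2
      rw [show 4 * k + 1 - 4 * j = 1 - 4 * (j - k) by ring, rf_chi_shift]
      push_cast
      rw [map_one, zpow_sub₀ (by norm_num : (-1 : ℂ) ≠ 0)]
      rw [show 2 * (1 - 4 * (j - k)) = 8 * (k - j) + 2 by ring]
      have : q ^ (-(4 * k)) * q ^ (1 - 4 * (j - k)) = q * q ^ (4 * (-j)) := by
        nth_rewrite 3 [← zpow_one q]
        rw [← zpow_add₀ hq, ← zpow_add₀ hq]; congr 1; ring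
      have n0 : (-1 : ℂ) ^ k ≠ 0 := zpow_ne_zero _ (by norm_num)
      have hk : (-1 : ℂ) ^ k * ((-1) ^ j / (-1) ^ k) = (-1) ^ j := mul_div_cancel₀ _ n0
      linear_combination (q ^ (-(4 * k)) * q ^ (1 - 4 * (j - k)) / (1 - q ^ (8 * (k - j) + 2)) * q ^ (4 * j ^ 2)) * hk
        + (-1) ^ j * q ^ (4 * j ^ 2) / (1 - q ^ (8 * (k - j) + 2)) * this
    have h := (rf_neg R2).tsum_eq
    rw [← h, rfTh, ← tsum_mul_left]
    congr 1; ext i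
    rw [show 4 * -i + 1 = 2 * (2 * -i) + 1 by ring, rfn2_oddv hq hq1, rf_neg_zpow, rf_pz, rf_pz, pow_zero]
    rw [rf_n1pow_neg, zpow_mul (-1 : ℂ) 2]
    norm_num
    have : q ^ (4 * i ^ 2) * q ^ (2 * i) = (q ^ (4 * i) * q ^ ((2 * i) ^ 2 + -(2 * i))) := by
      rw [← zpow_add₀ hq, ← zpow_add₀ hq]; congr 1; ring
    linear_combination rfn2 q 1 * (-1) ^ i * this

lemma rf_parity {F : ℤ × ℤ → ℂ} {s s0 s1 : ℂ} (h : HasSum F s)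
    (h0 : HasSum (fun x : ℤ × ℤ => F (x.1 - x.2, x.1 + x.2)) s0)
    (h1 : HasSum (fun x : ℤ × ℤ => F (x.1 - x.2, x.1 + x.2 + 1)) s1) : s = s0 + s1 := by
  let φ : (ℤ × ℤ) ⊕ (ℤ × ℤ) → ℤ × ℤ :=
    Sum.elim (fun x => (x.1 - x.2, x.1 + x.2)) (fun x => (x.1 - x.2, x.1 + x.2 + 1))
  have hφ : Function.Bijective φ := by
    constructor
    · rintro (⟨a, b⟩ | ⟨a, b⟩) (⟨c, d⟩ | ⟨c, d⟩) h <;>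
      simp only [φ, Sum.elim_inl, Sum.elim_inr, Prod.mk.injEq] at h
      · rw [show a = c by omega, show b = d by omega]
      · omega
      · omega
      · rw [show a = c by omega, show b = d by omega]
    · rintro ⟨j, k⟩
      rcases Int.even_or_odd' (j + k) with ⟨u, hu | hu⟩
      · exact ⟨Sum.inl (u, u - j), by simp only [φ, Sum.elim_inl, Prod.mk.injEq]; omega⟩
      · exact ⟨Sum.inr (u, u - j), by simp only [φ, Sum.elim_inr, Prod.mk.injEq]; omega⟩
  have h2 : HasSum (F ∘ φ) s := (Equiv.ofBijective φ hφ).hasSum_iff.mpr h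
  exact h2.unique (HasSum.sum h0 h1)

lemma rf_even_only {f : ℤ → ℂ} {s : ℂ} (h : HasSum f s) (h0 : ∀ i, f (2 * i + 1) = 0) :
    HasSum (fun i => f (2 * i)) s := by
  have hi : Function.Injective (fun i : ℤ => 2 * i) := fun a b h => by simpa using h
  refine (hi.hasSum_iff ?_).mpr h
  intro x hx
  rcases Int.even_or_odd' x with ⟨c, rfl | rfl⟩
  · exact absurd ⟨c, rfl⟩ hx
  · exact h0 c

lemma rf_pow_lt {q : ℂ} (hq1 : ‖q‖ < 1) {n : ℕ} (hn : n ≠ 0) : ‖q ^ n‖ < 1 := by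
  rw [norm_pow]; exact pow_lt_one₀ (norm_nonneg _) hq1 hn

lemma rf_n1_even (i : ℤ) : (-1 : ℂ) ^ (2 * i) = 1 := by rw [zpow_mul]; norm_num
lemma rf_n1_odd (i : ℤ) : (-1 : ℂ) ^ (2 * i + 1) = -1 := by
  rw [zpow_add₀ (by norm_num), zpow_mul]; norm_num
lemma rf_n1_add (i j : ℤ) : (-1 : ℂ) ^ (i + j) = (-1) ^ i * (-1) ^ j := zpow_add₀ (by norm_num) _ _
lemma rf_n1_sub (i j : ℤ) : (-1 : ℂ) ^ (i - j) = (-1) ^ i * (-1) ^ j := by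
  rw [sub_eq_add_neg, rf_n1_add, rf_n1pow_neg]

/-- the product of two theta-type sums as a double sum -/
lemma rfTh_prod {q y z : ℂ} (hq : q ≠ 0) (hq1 : ‖q‖ < 1) (hy : y ≠ 0) (hz : z ≠ 0) (m n : ℕ) :
    HasSum (fun x : ℤ × ℤ => ((x.1 : ℂ) ^ m * (q ^ (x.1 ^ 2) * y ^ x.1)) *
      ((x.2 : ℂ) ^ n * (q ^ (x.2 ^ 2) * z ^ x.2))) (rfTh m q y * rfTh n q z) := by
  have h := rf_prod (f := fun j : ℤ => (j : ℂ) ^ m * (q ^ (j ^ 2) * y ^ j))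
    (g := fun j : ℤ => (j : ℂ) ^ n * (q ^ (j ^ 2) * z ^ j)) (rf_gsum hq hq1 hy m) (rf_gsum hq hq1 hz n)
  unfold rfTh
  exact h

lemma rf_R1 {q : ℂ} (hq : q ≠ 0) (hq1 : ‖q‖ < 1) :
    rfTh 0 q 1 * rfTh 0 q (-1) = rfTh 0 (q ^ 2) (-1) ^ 2 := by
  have hq2 : q ^ 2 ≠ 0 := pow_ne_zero _ hq
  have hq21 := rf_pow_lt hq1 two_ne_zero
  have n1 : (-1 : ℂ) ≠ 0 := by norm_num
  have h := rfTh_prod hq hq1 one_ne_zero n1 0 0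
  have h0 := rfTh_prod hq2 hq21 n1 n1 0 0
  have hy : -q ^ 2 ≠ 0 := neg_ne_zero.mpr hq2
  have h1 := (rfTh_prod hq2 hq21 hy hy 0 0).mul_left (-q)
  have hv : rfTh 0 (q ^ 2) (-q ^ 2) = 0 := by
    have := rf_vanish hq2 hq21 1 (by decide)
    rw [zpow_one] at this
    exact (rfTh_hasSum0 hq2 hq21 hy).unique this
  have := rf_parity h (rf_hcongr h0 (fun x => ?_) rfl) (rf_hcongr h1 (fun x => ?_) rfl)
  · rw [this, hv]; ring
  · simp only [pow_zero, one_mul, one_zpow, rf_n1_add, rf_pz, mul_one]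
    have : q ^ ((x.1 - x.2) ^ 2) * q ^ ((x.1 + x.2) ^ 2) = q ^ (((2 : ℕ) : ℤ) * x.1 ^ 2) * q ^ (((2 : ℕ) : ℤ) * x.2 ^ 2) := by
      rw [← zpow_add₀ hq, ← zpow_add₀ hq]; congr 1; push_cast; ring
    linear_combination (-1) ^ x.1 * (-1) ^ x.2 * this
  · simp only [pow_zero, one_mul, one_zpow, rf_n1_add, rf_pz, mul_one, zpow_one, rf_neg_zpow (q ^ 2)]
    have : q ^ ((x.1 - x.2) ^ 2) * q ^ ((x.1 + x.2 + 1) ^ 2) = q * (q ^ (((2 : ℕ) : ℤ) * x.1 ^ 2) * q ^ (((2 : ℕ) : ℤ) * x.1) * (q ^ (((2 : ℕ) : ℤ) * x.2 ^ 2) * q ^ (((2 : ℕ) : ℤ) * x.2))) := by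
      nth_rewrite 3 [← zpow_one q]
      simp only [← zpow_add₀ hq]; congr 1; push_cast; ring
    linear_combination -(-1) ^ x.1 * (-1) ^ x.2 * this

lemma rf_R2 {q : ℂ} (hq : q ≠ 0) (hq1 : ‖q‖ < 1) :
    rfTh 0 q 1 ^ 2 + rfTh 0 q (-1) ^ 2 = 2 * rfTh 0 (q ^ 2) 1 ^ 2 := by
  have hq2 : q ^ 2 ≠ 0 := pow_ne_zero _ hq
  have hq21 := rf_pow_lt hq1 two_ne_zero
  have n1 : (-1 : ℂ) ≠ 0 := by norm_num
  have h := (rfTh_prod hq hq1 one_ne_zero one_ne_zero 0 0).add (rfTh_prod hq hq1 n1 n1 0 0)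
  have h0 := (rfTh_prod hq2 hq21 one_ne_zero one_ne_zero 0 0).mul_left 2
  have := rf_parity h (rf_hcongr h0 (fun x => ?_) rfl) (rf_hcongr hasSum_zero (fun x => ?_) rfl)
  · linear_combination this
  · simp only [pow_zero, one_mul, one_zpow, rf_n1_add, rf_n1_sub, rf_pz, mul_one]
    have : q ^ ((x.1 - x.2) ^ 2) * q ^ ((x.1 + x.2) ^ 2) = q ^ (((2 : ℕ) : ℤ) * x.1 ^ 2) * q ^ (((2 : ℕ) : ℤ) * x.2 ^ 2) := by
      rw [← zpow_add₀ hq, ← zpow_add₀ hq]; congr 1; push_cast; ring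
    have e1 := rf_n1pow_sq x.1
    have e2 := rf_n1pow_sq x.2
    linear_combination 2 * this + q ^ ((x.1 - x.2) ^ 2) * q ^ ((x.1 + x.2) ^ 2) * ((-1) ^ x.2 * (-1) ^ x.2 * e1 + e2)
  · simp only [pow_zero, one_mul, one_zpow, rf_n1_add, rf_n1_sub, mul_one, zpow_one]
    have e1 := rf_n1pow_sq x.1
    have e2 := rf_n1pow_sq x.2
    linear_combination -q ^ ((x.1 - x.2) ^ 2) * q ^ ((x.1 + x.2 + 1) ^ 2) * ((-1) ^ x.2 * (-1) ^ x.2 * e1 + e2)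

lemma rf_R5 {q : ℂ} (hq : q ≠ 0) (hq1 : ‖q‖ < 1) :
    rfTh 0 q (-1) * rfTh 2 q 1 - rfTh 0 q 1 * rfTh 2 q (-1) = q * rfJ 1 (q ^ 2) ^ 2 := by
  have hq2 : q ^ 2 ≠ 0 := pow_ne_zero _ hq
  have hq21 := rf_pow_lt hq1 two_ne_zero
  have n1 : (-1 : ℂ) ≠ 0 := by norm_num
  have h := (rfTh_prod hq hq1 n1 one_ne_zero 0 2).sub (rfTh_prod hq hq1 one_ne_zero n1 0 2)
  have hy : -q ^ 2 ≠ 0 := neg_ne_zero.mpr hq2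
  have T := fun m n => rfTh_prod hq2 hq21 hy hy m n
  have h1 := ((((((T 2 0).add ((T 1 1).mul_left 2)).add (T 0 2)).add ((T 1 0).mul_left 2)).add ((T 0 1).mul_left 2)).add (T 0 0)).mul_left (2 * q)
  have hv : rfTh 0 (q ^ 2) (-q ^ 2) = 0 := by
    have := rf_vanish hq2 hq21 1 (by decide)
    rw [zpow_one] at this
    exact (rfTh_hasSum0 hq2 hq21 hy).unique this
  have hJ : rfJ 1 (q ^ 2) = 2 * rfTh 1 (q ^ 2) (-q ^ 2) := by
    have := ((rfTh_hasSum hq2 hq21 hy 1).mul_left 2).add (rfTh_hasSum0 hq2 hq21 hy)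
    rw [hv, add_zero] at this
    rw [← this.tsum_eq, rfJ]
    congr 1; ext i; push_cast; ring
  have := rf_parity h (rf_hcongr hasSum_zero (fun x => ?_) rfl) (rf_hcongr h1 (fun x => ?_) rfl)
  · rw [this, hv, hJ]; ring
  · simp only [pow_zero, one_mul, one_zpow, rf_n1_add, rf_n1_sub, mul_one]
    ring
  · simp only [pow_zero, one_mul, one_zpow, rf_n1_add, rf_n1_sub, rf_pz, mul_one, zpow_one, rf_neg_zpow (q ^ 2), pow_one]
    have : q ^ ((x.1 - x.2) ^ 2) * q ^ ((x.1 + x.2 + 1) ^ 2) = q * (q ^ (((2 : ℕ) : ℤ) * x.1 ^ 2) * q ^ (((2 : ℕ) : ℤ) * x.1) * (q ^ (((2 : ℕ) : ℤ) * x.2 ^ 2) * q ^ (((2 : ℕ) : ℤ) * x.2))) := by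
      nth_rewrite 3 [← zpow_one q]
      simp only [← zpow_add₀ hq]; congr 1; push_cast; ring
    have hc : ((x.1 + x.2 + 1 : ℤ) : ℂ) = x.1 + x.2 + 1 := by push_cast; ring
    rw [hc]
    linear_combination 2 * (x.1 + x.2 + 1 : ℂ) ^ 2 * (-1) ^ x.1 * (-1) ^ x.2 * this

lemma rf_R3 {q : ℂ} (hq : q ≠ 0) (hq1 : ‖q‖ < 1) :
    rfTh 0 q 1 + rfTh 0 q (-1) = 2 * rfTh 0 (q ^ 4) 1 ∧
    rfTh 2 q 1 + rfTh 2 q (-1) = 8 * rfTh 2 (q ^ 4) 1 ∧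
    HasSum (fun i : ℤ => 2 * q * q ^ (4 * i ^ 2 + 4 * i)) (rfTh 0 q 1 - rfTh 0 q (-1)) := by
  have hq4 : q ^ 4 ≠ 0 := pow_ne_zero _ hq
  have hq41 := rf_pow_lt hq1 (n := 4) (by norm_num)
  have n1 : (-1 : ℂ) ≠ 0 := by norm_num
  refine ⟨?_, ?_, ?_⟩
  · have h := rf_even_only ((rfTh_hasSum0 hq hq1 one_ne_zero).add (rfTh_hasSum0 hq hq1 n1)) (fun i => by
      rw [rf_n1_odd, one_zpow]; ring)
    refine h.unique (rf_hcongr ((rfTh_hasSum0 hq4 hq41 one_ne_zero).mul_left 2) (fun i => ?_) rfl)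
    rw [rf_n1_even, one_zpow, one_zpow, rf_pz, show (2 * i) ^ 2 = ((4 : ℕ) : ℤ) * i ^ 2 by push_cast; ring]; ring
  · have h := rf_even_only ((rfTh_hasSum hq hq1 one_ne_zero 2).add (rfTh_hasSum hq hq1 n1 2)) (fun i => by
      rw [rf_n1_odd, one_zpow]; ring)
    refine h.unique (rf_hcongr ((rfTh_hasSum hq4 hq41 one_ne_zero 2).mul_left 8) (fun i => ?_) rfl)
    rw [rf_n1_even, one_zpow, one_zpow, rf_pz, show (2 * i) ^ 2 = ((4 : ℕ) : ℤ) * i ^ 2 by push_cast; ring]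
    push_cast; ring
  · have h := rf_odd_only ((rfTh_hasSum0 hq hq1 one_ne_zero).sub (rfTh_hasSum0 hq hq1 n1)) (fun i => by
      rw [rf_n1_even, one_zpow]; ring)
    refine rf_hcongr h (fun i => ?_) rfl
    rw [rf_n1_odd, one_zpow, show (2 * i + 1) ^ 2 = 4 * i ^ 2 + 4 * i + 1 by ring, zpow_add_one₀ hq]
    ring

lemma rf_R6 {q : ℂ} (hq : q ≠ 0) (hq1 : ‖q‖ < 1) : rfJ 1 q = 2 * rfP (q ^ 2) ^ 3 := by
  have hy : -q⁻¹ ≠ 0 := neg_ne_zero.mpr (inv_ne_zero hq)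
  have h := rfTh_hasSum hq hq1 hy 1
  have hv : rfTh 1 q (-q⁻¹) = -rfP (q ^ 2) ^ 3 := by
    rw [← rf_jacobi hq hq1, rfTh]; simp only [pow_one]
  rw [hv] at h
  have h0 := rf_vanish hq hq1 1 (by decide)
  rw [zpow_one] at h0
  have h2 := ((rf_shift h 1).mul_left (-2)).sub h0
  have : HasSum (fun i : ℤ => ((2 * i + 1 : ℤ) : ℂ) ^ 1 * (q ^ (i ^ 2) * (-q) ^ i)) (2 * rfP (q ^ 2) ^ 3) := by
    refine rf_hcongr h2 (fun i => ?_) (by ring)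
    rw [rf_inv_neg_one_zpow, rf_neg_zpow, rf_n1_add]
    have : q ^ ((i + 1) ^ 2) * q ^ (-(i + 1)) = q ^ (i ^ 2) * q ^ i := by
      simp only [← zpow_add₀ hq]; congr 1; ring
    push_cast
    simp only [zpow_one]
    linear_combination (-2) * ((i : ℂ) + 1) * (-1) ^ i * this
  exact this.tsum_eq

lemma rf_oddprod {q : ℂ} (hq1 : ‖q‖ < 1) : Filter.Tendsto
    (fun n => ∏ k ∈ range n, (1 - q ^ (2 * k + 1))) Filter.atTop (nhds (rfP q / rfP (q ^ 2))) := by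
  have hq21 := rf_pow_lt hq1 two_ne_zero
  have h2 := rfPn_tendsto hq21
  have h1 := (rfPn_tendsto hq1).comp (Filter.tendsto_id.const_mul_atTop' (r := 2) (by norm_num))
  have := h1.div h2 (rfP_ne hq21)
  refine this.congr fun n => ?_
  simp only [Function.comp, Pi.div_apply, id]
  rw [div_eq_iff (rfPn_ne hq21 n)]
  induction n with
  | zero => simp [rfPn]
  | succ n ih =>
    rw [prod_range_succ, rfPn_succ, show 2 * (n + 1) = 2 * n + 1 + 1 by ring, rfPn_succ, rfPn_succ, ih]
    rw [← pow_mul]; ring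

lemma rf_R7 {q : ℂ} (hq : q ≠ 0) (hq1 : ‖q‖ < 1) :
    rfTh 0 q (-1) = rfP q ^ 2 / rfP (q ^ 2) := by
  have hq21 := rf_pow_lt hq1 two_ne_zero
  have h := rf_triple hq hq1 hq (l := (rfP q / rfP (q ^ 2)) ^ 2) (by
    refine ((rf_oddprod hq1).pow 2).congr fun n => ?_
    rw [← prod_pow]
    refine prod_congr rfl fun k _ => ?_
    have : (q ^ 2) ^ (k + 1) / q = q ^ (2 * k + 1) := by
      rw [div_eq_iff hq, ← pow_mul]; ring
    rw [this, ← pow_mul]; ring)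
  rw [show -q⁻¹ * q = -1 by field_simp] at h
  rw [rfTh]
  simp only [pow_zero, one_mul]
  rw [h]
  have := rfP_ne hq21
  field_simp

lemma rf_R8 {q : ℂ} (hq : q ≠ 0) (hq1 : ‖q‖ < 1) :
    rfTh 0 (q ^ 4) (-q ^ 2) = rfP (q ^ 2) * rfP (q ^ 8) / rfP (q ^ 4) := by
  have hq21 := rf_pow_lt hq1 two_ne_zero
  have hq4 : q ^ 4 ≠ 0 := pow_ne_zero _ hq
  have hq41 := rf_pow_lt hq1 (n := 4) (by norm_num)
  have h := rf_triple hq4 hq41 (y := q ^ 6) (pow_ne_zero _ hq) (l := (rfP (q ^ 2) / rfP (q ^ 4))) (by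
    have h1 := (rf_oddprod hq21).comp (Filter.tendsto_id.const_mul_atTop' (r := 2) (by norm_num))
    rw [← pow_mul] at h1
    refine h1.congr fun n => ?_
    simp only [Function.comp, id]
    induction n with
    | zero => simp
    | succ n ih =>
      rw [prod_range_succ, show 2 * (n + 1) = 2 * n + 1 + 1 by ring, prod_range_succ, prod_range_succ, ih]
      have : ((q ^ 4) ^ 2) ^ (n + 1) / q ^ 6 = q ^ (8 * n + 2) := by
        rw [div_eq_iff (pow_ne_zero _ hq), ← pow_mul, ← pow_mul]; ring
      rw [this, ← pow_mul, ← pow_mul]; ring)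
  rw [show -(q ^ 4)⁻¹ * q ^ 6 = -q ^ 2 by field_simp, ← pow_mul] at h
  rw [rfTh]
  simp only [pow_zero, one_mul]
  rw [h]
  norm_num
  ring

lemma rf_R9 {q : ℂ} (hq : q ≠ 0) (hq1 : ‖q‖ < 1) :
    rfTh 0 q 1 - rfTh 0 q (-1) = 4 * q * rfP (q ^ 16) ^ 2 / rfP (q ^ 8) := by
  have hq4 : q ^ 4 ≠ 0 := pow_ne_zero _ hq
  have hq41 := rf_pow_lt hq1 (n := 4) (by norm_num)
  have hq81 := rf_pow_lt hq1 (n := 8) (by norm_num)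
  have hq161 := rf_pow_lt hq1 (n := 16) (by norm_num)
  have hE : Filter.Tendsto (fun n => ∏ k ∈ range n, (1 + (q ^ 8) ^ (k + 1))) Filter.atTop
      (nhds (rfP (q ^ 16) / rfP (q ^ 8))) := by
    refine ((rfPn_tendsto hq161).div (rfPn_tendsto hq81) (rfP_ne hq81)).congr fun n => ?_
    simp only [Pi.div_apply]
    rw [div_eq_iff (rfPn_ne hq81 n)]
    unfold rfPn
    rw [← prod_mul_distrib]
    refine prod_congr rfl fun k _ => ?_
    rw [← pow_mul, ← pow_mul]; ring
  have hx : Filter.Tendsto (fun n => 1 + (q ^ 8) ^ n) Filter.atTop (nhds (1 + 0)) :=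
    (tendsto_pow_atTop_nhds_zero_of_norm_lt_one hq81).const_add 1
  have h := rf_triple hq4 hq41 (y := -1) (by norm_num) (l := 2 * (rfP (q ^ 16) / rfP (q ^ 8)) ^ 2) (by
    have h1 := ((hE.pow 2).const_mul 2).div hx (by norm_num)
    rw [add_zero, div_one] at h1
    refine h1.congr fun n => ?_
    simp only [Pi.div_apply]
    have hn : 1 + (q ^ 8) ^ n ≠ 0 := by
      have := rf_den1 hq hq1 (2 * n)
      rw [← pow_mul]
      have e : q ^ (4 * (2 * (n : ℤ))) = q ^ (8 * n) := by
        rw [← zpow_natCast]; congr 1; push_cast; ring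
      rwa [e] at this
    rw [div_eq_iff hn, prod_mul_distrib]
    have e1 : ∏ k ∈ range n, (1 - -1 * ((q ^ 4) ^ 2) ^ k) = ∏ k ∈ range n, (1 + (q ^ 8) ^ k) :=
      prod_congr rfl fun k _ => by rw [← pow_mul]; ring
    have e2 : ∏ k ∈ range n, (1 - ((q ^ 4) ^ 2) ^ (k + 1) / -1) = ∏ k ∈ range n, (1 + (q ^ 8) ^ (k + 1)) :=
      prod_congr rfl fun k _ => by rw [← pow_mul]; ring
    have e3 := prod_range_succ (fun k => 1 + (q ^ 8) ^ k) n
    rw [prod_range_succ', pow_zero] at e3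
    rw [e1, e2]
    linear_combination (∏ k ∈ range n, (1 + (q ^ 8) ^ (k + 1))) * e3)
  have hy : -(q ^ 4)⁻¹ * -1 ≠ 0 := by
    rw [neg_mul_neg, mul_one]; exact inv_ne_zero hq4
  have hs := rfTh_hasSum0 hq4 hq41 hy
  have hv : rfTh 0 (q ^ 4) (-(q ^ 4)⁻¹ * -1) = rfP ((q ^ 4) ^ 2) * (2 * (rfP (q ^ 16) / rfP (q ^ 8)) ^ 2) := by
    rw [← h, rfTh]; simp only [pow_zero, one_mul]
  have h3 := (rf_neg hs).mul_left (2 * q)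
  have h4 := (rf_R3 hq hq1).2.2.unique (rf_hcongr h3 (fun i => ?_) rfl)
  · rw [h4, hv, ← pow_mul]
    have := rfP_ne hq81
    norm_num
    field_simp; ring
  · rw [neg_mul_neg, mul_one, neg_sq, inv_zpow, zpow_neg, inv_inv, rf_pz, rf_pz, zpow_add₀ hq]
    push_cast; ring

lemma rf_AP {q : ℂ} (hq : q ≠ 0) (hq1 : ‖q‖ < 1) :
    rfTh 0 q 1 = rfP (q ^ 2) ^ 5 / (rfP q ^ 2 * rfP (q ^ 4) ^ 2) := by
  have h1 := rf_R1 hq hq1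
  have hq2 : q ^ 2 ≠ 0 := pow_ne_zero _ hq
  have hq21 := rf_pow_lt hq1 two_ne_zero
  have hq41 := rf_pow_lt hq1 (n := 4) (by norm_num)
  have e4 : (q ^ 2) ^ 2 = q ^ 4 := by ring
  rw [rf_R7 hq hq1, rf_R7 hq2 hq21, e4] at h1
  have p1 := rfP_ne hq1
  have p2 := rfP_ne hq21
  have p4 := rfP_ne hq41
  rw [eq_div_iff (by positivity)]
  field_simp at h1
  linear_combination h1

lemma rf_A_ne {q : ℂ} (hq : q ≠ 0) (hq1 : ‖q‖ < 1) : rfTh 0 q 1 ≠ 0 := by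
  rw [rf_AP hq hq1]
  have p1 := rfP_ne hq1
  have p2 := rfP_ne (rf_pow_lt hq1 two_ne_zero)
  have p4 := rfP_ne (rf_pow_lt hq1 (n := 4) (by norm_num))
  positivity

lemma rf_B_ne {q : ℂ} (hq : q ≠ 0) (hq1 : ‖q‖ < 1) : rfTh 0 q (-1) ≠ 0 := by
  rw [rf_R7 hq hq1]
  have p1 := rfP_ne hq1
  have p2 := rfP_ne (rf_pow_lt hq1 two_ne_zero)
  positivity

lemma rf_sqdiff {q : ℂ} (hq : q ≠ 0) (hq1 : ‖q‖ < 1) :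
    rfTh 0 q 1 ^ 2 - rfTh 0 q (-1) ^ 2 = 8 * q * rfP (q ^ 8) ^ 4 / rfP (q ^ 4) ^ 2 := by
  have h1 := (rf_R3 hq hq1).1
  have h2 := rf_R9 hq hq1
  have hq4 : q ^ 4 ≠ 0 := pow_ne_zero _ hq
  have hq41 := rf_pow_lt hq1 (n := 4) (by norm_num)
  have p4 := rfP_ne hq41
  have p8 := rfP_ne (rf_pow_lt hq1 (n := 8) (by norm_num))
  have p16 := rfP_ne (rf_pow_lt hq1 (n := 16) (by norm_num))
  have e := rf_AP hq4 hq41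
  rw [← pow_mul, ← pow_mul] at e
  norm_num at e
  rw [e] at h1
  rw [show rfTh 0 q 1 ^ 2 - rfTh 0 q (-1) ^ 2 = (rfTh 0 q 1 - rfTh 0 q (-1)) * (rfTh 0 q 1 + rfTh 0 q (-1)) by ring,
    h1, h2]
  field_simp; ring

lemma rf_qdiff {q : ℂ} (hq : q ≠ 0) (hq1 : ‖q‖ < 1) :
    rfTh 0 q 1 ^ 4 - rfTh 0 q (-1) ^ 4 = 16 * q * rfP (q ^ 4) ^ 8 / rfP (q ^ 2) ^ 4 := by
  have h1 := rf_R2 hq hq1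
  have h2 := rf_sqdiff hq hq1
  have hq2 : q ^ 2 ≠ 0 := pow_ne_zero _ hq
  have hq21 := rf_pow_lt hq1 two_ne_zero
  have p2 := rfP_ne hq21
  have p4 := rfP_ne (rf_pow_lt hq1 (n := 4) (by norm_num))
  have p8 := rfP_ne (rf_pow_lt hq1 (n := 8) (by norm_num))
  have e := rf_AP hq2 hq21
  rw [← pow_mul, ← pow_mul] at e
  norm_num at e
  rw [e] at h1
  rw [show rfTh 0 q 1 ^ 4 - rfTh 0 q (-1) ^ 4 = (rfTh 0 q 1 ^ 2 - rfTh 0 q (-1) ^ 2) * (rfTh 0 q 1 ^ 2 + rfTh 0 q (-1) ^ 2) by ring,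
    h1, h2]
  field_simp; ring

lemma rf_L0 {q : ℂ} (hq : q ≠ 0) (hq1 : ‖q‖ < 1) :
    q * rfJ 1 q ^ 4 = rfTh 0 q 1 ^ 4 * rfTh 0 q (-1) ^ 4 * (rfTh 0 q 1 ^ 4 - rfTh 0 q (-1) ^ 4) := by
  have p1 := rfP_ne hq1
  have p2 := rfP_ne (rf_pow_lt hq1 two_ne_zero)
  have p4 := rfP_ne (rf_pow_lt hq1 (n := 4) (by norm_num))
  rw [rf_qdiff hq hq1, rf_AP hq hq1, rf_R7 hq hq1, rf_R6 hq hq1]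
  field_simp; ring

lemma rf_wron {q : ℂ} (hq : q ≠ 0) (hq1 : ‖q‖ < 1) :
    rfTh 0 q (-1) * rfTh 2 q 1 - rfTh 0 q 1 * rfTh 2 q (-1) =
      rfTh 0 q 1 * rfTh 0 q (-1) * (rfTh 0 q 1 ^ 4 - rfTh 0 q (-1) ^ 4) / 4 := by
  have hq2 : q ^ 2 ≠ 0 := pow_ne_zero _ hq
  have hq21 := rf_pow_lt hq1 two_ne_zero
  have p1 := rfP_ne hq1
  have p2 := rfP_ne (rf_pow_lt hq1 two_ne_zero)
  have p4 := rfP_ne (rf_pow_lt hq1 (n := 4) (by norm_num))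
  rw [rf_R5 hq hq1, rf_qdiff hq hq1, rf_AP hq hq1, rf_R7 hq hq1, rf_R6 hq2 hq21, ← pow_mul]
  norm_num
  field_simp; ring

/-- termwise differentiation of sparse power series -/
lemma rf_theta {c : ℤ → ℂ} {N : ℤ → ℕ} {q : ℂ} (hq1 : ‖q‖ < 1)
    (hs : ∀ ρ : ℝ, 0 < ρ → ρ < 1 → Summable fun i => ‖c i‖ * ρ ^ N i) :
    DifferentiableAt ℂ (fun w => ∑' i, c i * w ^ N i) q ∧
    HasSum (fun i => c i * (N i * q ^ N i)) (q * deriv (fun w => ∑' i, c i * w ^ N i) q) := by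
  set ρ := (1 + ‖q‖) / 2 with hρ
  have h0 : 0 < ρ := by have := norm_nonneg q; rw [hρ]; linarith
  have h1 : ρ < 1 := by rw [hρ]; linarith
  have h2 : ‖q‖ < ρ := by rw [hρ]; linarith
  have hU : IsOpen (Metric.ball (0 : ℂ) ρ) := Metric.isOpen_ball
  have hm : q ∈ Metric.ball (0 : ℂ) ρ := by simpa using h2
  have hf : ∀ i, DifferentiableOn ℂ (fun w : ℂ => c i * w ^ N i) (Metric.ball (0 : ℂ) ρ) := fun i => by
    fun_prop
  have hb : ∀ i w, w ∈ Metric.ball (0 : ℂ) ρ → ‖c i * w ^ N i‖ ≤ ‖c i‖ * ρ ^ N i := fun i w hw => by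
    rw [norm_mul, norm_pow]
    have : ‖w‖ ≤ ρ := by simpa using (mem_ball_zero_iff.mp hw).le
    gcongr
  refine ⟨(Complex.differentiableOn_tsum_of_summable_norm (hs ρ h0 h1) hf hU hb).differentiableAt
    (hU.mem_nhds hm), ?_⟩
  refine rf_hcongr ((Complex.hasSum_deriv_of_summable_norm (hs ρ h0 h1) hf hU hb hm).mul_left q)
    (fun i => ?_) rfl
  simp only [deriv_const_mul_field', deriv_pow_field]
  rcases Nat.eq_zero_or_pos (N i) with h | h
  · simp [h]
  · obtain ⟨m, hm⟩ : ∃ m, N i = m + 1 := ⟨N i - 1, by omega⟩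
    rw [hm]; simp; ring

lemma rfTh_deriv {q y : ℂ} (hq1 : ‖q‖ < 1) (hy : ‖y‖ = 1) :
    DifferentiableAt ℂ (fun w => rfTh 0 w y) q ∧ q * deriv (fun w => rfTh 0 w y) q = rfTh 2 q y := by
  have e : (fun w => rfTh 0 w y) = fun w => ∑' j : ℤ, y ^ j * w ^ ((j ^ 2).toNat) := by
    ext w
    unfold rfTh
    congr 1; ext j
    have : w ^ (j ^ 2) = w ^ ((j ^ 2).toNat) := by
      rw [← zpow_natCast, Int.toNat_of_nonneg (sq_nonneg j)]
    rw [this]; ring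
  rw [e]
  have h := rf_theta (c := fun j : ℤ => y ^ j) (N := fun j => (j ^ 2).toNat) hq1 (fun ρ h0 h1 => by
    have := rf_gsum0 (q := (ρ : ℂ)) (y := 1) (by exact_mod_cast h0.ne') (by
      rw [Complex.norm_real, Real.norm_eq_abs, abs_of_pos h0]; exact h1) one_ne_zero
    refine this.congr fun j => ?_
    simp only [norm_zpow, norm_mul, hy, one_zpow, one_mul, mul_one, norm_one, Complex.norm_real, Real.norm_eq_abs, abs_of_pos h0]
    rw [← zpow_natCast, Int.toNat_of_nonneg (sq_nonneg j)])
  refine ⟨h.1, ?_⟩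
  rw [← h.2.tsum_eq, rfTh]
  congr 1; ext j
  have : q ^ (j ^ 2) = q ^ ((j ^ 2).toNat) := by
    rw [← zpow_natCast, Int.toNat_of_nonneg (sq_nonneg j)]
  have h3 : (((j ^ 2).toNat : ℕ) : ℂ) = (j : ℂ) ^ 2 := by
    have : (((j ^ 2).toNat : ℤ) : ℂ) = ((j ^ 2 : ℤ) : ℂ) := by rw [Int.toNat_of_nonneg (sq_nonneg j)]
    rw [Int.cast_natCast] at this
    rw [this]; push_cast; ring
  rw [this, h3]; ring

lemma rf_ii (i : ℤ) : 0 ≤ i ^ 2 + i := by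
  rcases le_or_gt 0 i with h | h
  · positivity
  · nlinarith

lemma rfJ_term {w : ℂ} (hw : w ≠ 0) (i : ℤ) : w ^ (i ^ 2) * (-w) ^ i = (-1) ^ i * w ^ ((i ^ 2 + i).toNat) := by
  rw [← zpow_natCast, Int.toNat_of_nonneg (rf_ii i), rf_neg_zpow, zpow_add₀ hw]; ring

lemma rfJ_deriv {q : ℂ} (hq : q ≠ 0) (hq1 : ‖q‖ < 1) :
    DifferentiableAt ℂ (rfJ 1) q ∧ 4 * (q * deriv (rfJ 1) q) = rfJ 3 q - rfJ 1 q := by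
  have e : rfJ 1 =ᶠ[nhds q] fun w => ∑' i : ℤ, ((2 * i + 1 : ℤ) : ℂ) * (-1) ^ i * w ^ ((i ^ 2 + i).toNat) := by
    filter_upwards [isOpen_ne.mem_nhds hq] with w hw
    unfold rfJ
    congr 1; ext i
    rw [rfJ_term hw]; ring
  have h := rf_theta (c := fun i : ℤ => ((2 * i + 1 : ℤ) : ℂ) * (-1) ^ i) (N := fun i => (i ^ 2 + i).toNat) hq1 (fun ρ h0 h1 => by
    have hρ : (ρ : ℂ) ≠ 0 := by exact_mod_cast h0.ne'
    have hρ1 : ‖(ρ : ℂ)‖ < 1 := by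
      rw [Complex.norm_real, Real.norm_eq_abs, abs_of_pos h0]; exact h1
    have s1 := rf_gsum' hρ hρ1 (y := -ρ) (neg_ne_zero.mpr hρ) 1
    have s0 := rf_gsum' hρ hρ1 (y := -ρ) (neg_ne_zero.mpr hρ) 0
    have := ((s1.mul_left 2).add s0).norm
    refine this.congr fun i => ?_
    rw [rfJ_term hρ]
    rw [show (2 * ((i : ℂ) ^ 1 * ((-1) ^ i * (ρ : ℂ) ^ (i ^ 2 + i).toNat)) + (i : ℂ) ^ 0 * ((-1) ^ i * (ρ : ℂ) ^ (i ^ 2 + i).toNat)) =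
      ((2 * i + 1 : ℤ) : ℂ) * (-1) ^ i * (ρ : ℂ) ^ (i ^ 2 + i).toNat by push_cast; ring]
    rw [norm_mul _ ((ρ : ℂ) ^ _), norm_pow, Complex.norm_real, Real.norm_eq_abs, abs_of_pos h0])
  refine ⟨e.differentiableAt_iff.mpr h.1, ?_⟩
  rw [e.deriv_eq]
  have hJ1 : HasSum (fun i : ℤ => ((2 * i + 1 : ℤ) : ℂ) ^ 1 * (q ^ (i ^ 2) * (-q) ^ i)) (rfJ 1 q) := by
    have hs := rf_gsum' hq hq1 (neg_ne_zero.mpr hq)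
    have : Summable (fun i : ℤ => ((2 * i + 1 : ℤ) : ℂ) ^ 1 * (q ^ (i ^ 2) * (-q) ^ i)) := by
      refine (((hs 1).mul_left 2).add (hs 0)).congr fun i => ?_
      push_cast; ring
    exact this.hasSum
  have h4 := (h.2.mul_left 4).add hJ1
  have : 4 * (q * deriv (fun w => ∑' i : ℤ, ((2 * i + 1 : ℤ) : ℂ) * (-1) ^ i * w ^ ((i ^ 2 + i).toNat)) q) + rfJ 1 q = rfJ 3 q := by
    rw [← h4.tsum_eq]
    conv_rhs => rw [rfJ]
    congr 1; ext i
    have h3 : (((i ^ 2 + i).toNat : ℕ) : ℂ) = (i : ℂ) ^ 2 + i := by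
      have : (((i ^ 2 + i).toNat : ℤ) : ℂ) = ((i ^ 2 + i : ℤ) : ℂ) := by rw [Int.toNat_of_nonneg (rf_ii i)]
      rw [Int.cast_natCast] at this
      rw [this]; push_cast; ring
    rw [rfJ_term hq, h3]; push_cast; ring
  linear_combination this

theorem rf_L {q : ℂ} (hq : q ≠ 0) (hq1 : ‖q‖ < 1) :
    rfJ 3 q * rfTh 0 q 1 = rfJ 1 q * (12 * rfTh 2 q 1 +
      rfTh 0 q 1 * (2 * rfTh 0 q (-1) ^ 4 - rfTh 0 q 1 ^ 4)) := by
  obtain ⟨da, ha⟩ := rfTh_deriv (y := 1) hq1 (by simp)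
  obtain ⟨db, hb⟩ := rfTh_deriv (y := -1) hq1 (by simp)
  obtain ⟨dj, hj⟩ := rfJ_deriv hq hq1
  have E : (fun w => w * rfJ 1 w ^ 4) =ᶠ[nhds q] fun w =>
      rfTh 0 w 1 ^ 4 * rfTh 0 w (-1) ^ 4 * (rfTh 0 w 1 ^ 4 - rfTh 0 w (-1) ^ 4) := by
    filter_upwards [isOpen_ne.mem_nhds hq,
      (isOpen_lt continuous_norm continuous_const).mem_nhds hq1] with w hw hw1
    exact rf_L0 hw hw1
  have D := E.deriv_eq
  have D1 := ((hasDerivAt_id q).mul (dj.hasDerivAt.pow 4)).deriv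
  have A4 := da.hasDerivAt.pow 4
  have B4 := db.hasDerivAt.pow 4
  have D2 := ((A4.mul B4).mul (A4.sub B4)).deriv
  have D3 := D1.symm.trans (D.trans D2)
  have w := rf_wron hq hq1
  have hL := rf_L0 hq hq1
  have hJ : rfJ 1 q ≠ 0 := by
    rw [rf_R6 hq hq1]
    have := rfP_ne (rf_pow_lt hq1 two_ne_zero)
    exact mul_ne_zero two_ne_zero (pow_ne_zero _ this)
  have hX : q * rfJ 1 q ^ 4 ≠ 0 := mul_ne_zero hq (pow_ne_zero _ hJ)
  apply mul_left_cancel₀ hX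
  simp only [id, Pi.pow_apply, Pi.mul_apply, Pi.sub_apply] at D3
  norm_num at D3
  generalize deriv (fun w => rfTh 0 w 1) q = a' at *
  generalize deriv (fun w => rfTh 0 w (-1)) q = b' at *
  generalize deriv (rfJ 1) q = j' at *
  rw [← ha, ← hb] at w
  rw [← ha]
  have hj3 : rfJ 3 q = 4 * (q * j') + rfJ 1 q := by linear_combination -hj
  rw [hj3]
  generalize rfTh 0 q 1 = a at *
  generalize rfTh 0 q (-1) = b at *
  generalize rfJ 1 q = J at *
  linear_combination (a * J * q) * D3 - 4 * J * a ^ 4 * b ^ 3 * (a ^ 4 - 2 * b ^ 4) * w - J * (12 * (q * a') + a * (2 * b ^ 4 - a ^ 4)) * hL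

lemma rf_AP2 {q : ℂ} (hq : q ≠ 0) (hq1 : ‖q‖ < 1) :
    rfTh 0 (q ^ 2) 1 = rfP (q ^ 4) ^ 5 / (rfP (q ^ 2) ^ 2 * rfP (q ^ 8) ^ 2) := by
  have e := rf_AP (pow_ne_zero 2 hq) (rf_pow_lt hq1 two_ne_zero)
  rw [← pow_mul, ← pow_mul] at e
  norm_num at e
  exact e

theorem rf_E1 {q : ℂ} (hq : q ≠ 0) (hq1 : ‖q‖ < 1) :
    q * rfP (q ^ 2) ^ 11 * rfP (q ^ 8) ^ 2 / (rfP q ^ 2 * rfP (q ^ 4) ^ 3) =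
      rfTh 0 (q ^ 2) 1 * rfTh 0 q 1 ^ 3 * rfTh 0 q (-1) ^ 2 * (rfTh 0 q 1 ^ 2 - rfTh 0 q (-1) ^ 2) / 8 := by
  have p1 := rfP_ne hq1
  have p2 := rfP_ne (rf_pow_lt hq1 two_ne_zero)
  have p4 := rfP_ne (rf_pow_lt hq1 (n := 4) (by norm_num))
  have p8 := rfP_ne (rf_pow_lt hq1 (n := 8) (by norm_num))
  rw [rf_sqdiff hq hq1, rf_AP hq hq1, rf_R7 hq hq1, rf_AP2 hq hq1]
  field_simp

theorem rf_E2 {q : ℂ} (hq : q ≠ 0) (hq1 : ‖q‖ < 1) :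
    q * rfP q ^ 2 * rfP (q ^ 4) ^ 11 / (rfP (q ^ 2) ^ 3 * rfP (q ^ 8) ^ 2) =
      rfTh 0 (q ^ 2) 1 * rfTh 0 q 1 * rfTh 0 q (-1) ^ 2 * (rfTh 0 q 1 ^ 4 - rfTh 0 q (-1) ^ 4) / 16 := by
  have p1 := rfP_ne hq1
  have p2 := rfP_ne (rf_pow_lt hq1 two_ne_zero)
  have p4 := rfP_ne (rf_pow_lt hq1 (n := 4) (by norm_num))
  have p8 := rfP_ne (rf_pow_lt hq1 (n := 8) (by norm_num))
  rw [rf_qdiff hq hq1, rf_AP hq hq1, rf_R7 hq hq1, rf_AP2 hq hq1]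
  field_simp

theorem rf_G1 {q : ℂ} (hq : q ≠ 0) (hq1 : ‖q‖ < 1) :
    ∑' d : ℤ, (d : ℂ) ^ 3 * rfg1 q d =
      rfTh 0 (q ^ 2) 1 * rfTh 0 q 1 * (rfTh 0 q 1 ^ 2 - rfTh 0 q (-1) ^ 2) / 4 *
      (3 / 4 * rfTh 0 q 1 * (rfTh 0 q 1 - rfTh 0 q (-1)) * (rfTh 0 q 1 ^ 2 + rfTh 0 q (-1) ^ 2)
        + rfTh 0 q 1 * rfTh 0 q (-1) * (rfTh 0 q 1 ^ 2 + rfTh 0 q (-1) ^ 2)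
        - (rfTh 0 q 1 + rfTh 0 q (-1)) ^ 4 / 16) := by
  have hq2 : q ^ 2 ≠ 0 := pow_ne_zero _ hq
  have hq21 := rf_pow_lt hq1 two_ne_zero
  have hq4 : q ^ 4 ≠ 0 := pow_ne_zero _ hq
  have hq41 := rf_pow_lt hq1 (n := 4) (by norm_num)
  have p1 := rfP_ne hq1
  have p2 := rfP_ne hq21
  have p4 := rfP_ne hq41
  have p8 := rfP_ne (rf_pow_lt hq1 (n := 8) (by norm_num))
  obtain ⟨k1, k3, ks⟩ := rf_case1 hq hq1
  have hb := rf_B_ne hq hq1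
  have he := rf_A_ne hq4 hq41
  rw [rf_R8 hq hq1] at ks
  have hJ := rf_R6 hq4 hq41
  rw [← pow_mul] at hJ
  norm_num at hJ
  have hn : rfn1 q 1 = q * rfP (q ^ 2) ^ 2 * rfP (q ^ 4) / rfP (q ^ 8) := by
    field_simp at ks ⊢
    linear_combination ks
  have G : ∑' d : ℤ, (d : ℂ) * rfg1 q d = rfTh 0 (q ^ 2) 1 * rfTh 0 q 1 * (rfTh 0 q 1 ^ 2 - rfTh 0 q (-1) ^ 2) / 4 := by
    have h : (∑' d : ℤ, (d : ℂ) * rfg1 q d) * rfTh 0 q (-1) =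
        rfTh 0 (q ^ 2) 1 * rfTh 0 q 1 * (rfTh 0 q 1 ^ 2 - rfTh 0 q (-1) ^ 2) / 4 * rfTh 0 q (-1) := by
      rw [← k1, hJ, hn, rf_sqdiff hq hq1, rf_AP hq hq1, rf_R7 hq hq1, rf_AP2 hq hq1]
      field_simp
      norm_num
    exact mul_right_cancel₀ hb h
  rw [← G]
  have L := rf_L hq4 hq41
  have w := rf_wron hq hq1
  obtain ⟨r3, r32, -⟩ := rf_R3 hq hq1
  have r1 := rf_R1 hq hq1
  have r2 := rf_R2 hq hq1
  have r12 := rf_R1 hq2 hq21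
  rw [← pow_mul] at r12
  norm_num at r12
  have hB : rfTh 0 (q ^ 4) (-1) ^ 4 = (rfTh 0 q 1 ^ 2 + rfTh 0 q (-1) ^ 2) / 2 * (rfTh 0 q 1 * rfTh 0 q (-1)) := by
    calc rfTh 0 (q ^ 4) (-1) ^ 4 = (rfTh 0 (q ^ 4) (-1) ^ 2) ^ 2 := by ring
      _ = _ := by rw [← r12, r1, r2]; ring
  rw [hB] at L
  have he' : rfTh 0 (q ^ 4) 1 = (rfTh 0 q 1 + rfTh 0 q (-1)) / 2 := by linear_combination -r3 / 2
  have he2 : rfTh 2 (q ^ 4) 1 = (rfTh 2 q 1 + rfTh 2 q (-1)) / 8 := by linear_combination -r32 / 8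
  rw [he'] at L he
  rw [he2] at L
  apply mul_left_cancel₀ (mul_ne_zero hb he)
  generalize (∑' d : ℤ, (d : ℂ) * rfg1 q d) = G1 at *
  generalize (∑' d : ℤ, (d : ℂ) ^ 3 * rfg1 q d) = G3 at *
  generalize rfTh 0 q 1 = a at *
  generalize rfTh 0 q (-1) = b at *
  linear_combination (-((a + b) / 2)) * k3 + rfn1 q 1 * L + (3 / 2 * (rfTh 2 q 1 + rfTh 2 q (-1)) + (a + b) / 2 * ((a ^ 2 + b ^ 2) * (a * b) - ((a + b) / 2) ^ 4)) * k1 + 3 / 2 * G1 * w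

theorem rf_G2 {q : ℂ} (hq : q ≠ 0) (hq1 : ‖q‖ < 1) :
    ∑' d : ℤ, (d : ℂ) ^ 3 * rfg2 q d =
      rfTh 0 q 1 * rfTh 0 q (-1) * rfTh 0 (q ^ 2) 1 * (rfTh 0 q 1 - rfTh 0 q (-1)) / 2 *
      (- rfTh 0 q 1 ^ 4 + 3 * rfTh 0 q 1 ^ 3 * rfTh 0 q (-1) - 3 * rfTh 0 q 1 ^ 2 * rfTh 0 q (-1) ^ 2
        + 3 * rfTh 0 q 1 * rfTh 0 q (-1) ^ 3 - rfTh 0 q (-1) ^ 4) := by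
  have hq2 : q ^ 2 ≠ 0 := pow_ne_zero _ hq
  have hq21 := rf_pow_lt hq1 two_ne_zero
  have hq4 : q ^ 4 ≠ 0 := pow_ne_zero _ hq
  have hq41 := rf_pow_lt hq1 (n := 4) (by norm_num)
  have p1 := rfP_ne hq1
  have p2 := rfP_ne hq21
  have p4 := rfP_ne hq41
  have p8 := rfP_ne (rf_pow_lt hq1 (n := 8) (by norm_num))
  obtain ⟨k1, k3, ks⟩ := rf_case2 hq hq1
  have ha := rf_A_ne hq hq1
  have he := rf_A_ne hq4 hq41
  rw [rf_R8 hq hq1] at ks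
  have hJ := rf_R6 hq hq1
  have hn : rfn2 q 1 = q * rfP (q ^ 8) ^ 2 * rfP (q ^ 4) / rfP (q ^ 2) := by
    field_simp at ks ⊢
    linear_combination ks
  obtain ⟨r3, r32, -⟩ := rf_R3 hq hq1
  have he' : rfTh 0 (q ^ 4) 1 = (rfTh 0 q 1 + rfTh 0 q (-1)) / 2 := by linear_combination -r3 / 2
  have he2 : rfTh 2 (q ^ 4) 1 = (rfTh 2 q 1 + rfTh 2 q (-1)) / 8 := by linear_combination -r32 / 8
  rw [he'] at k1 k3 he
  rw [he2] at k3
  have G : ∑' d : ℤ, (d : ℂ) * rfg2 q d = rfTh 0 q 1 * rfTh 0 q (-1) * rfTh 0 (q ^ 2) 1 * (rfTh 0 q 1 - rfTh 0 q (-1)) / 2 := by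
    have h : (∑' d : ℤ, (d : ℂ) * rfg2 q d) * ((rfTh 0 q 1 + rfTh 0 q (-1)) / 2) =
        rfTh 0 q 1 * rfTh 0 q (-1) * rfTh 0 (q ^ 2) 1 * (rfTh 0 q 1 - rfTh 0 q (-1)) / 2 * ((rfTh 0 q 1 + rfTh 0 q (-1)) / 2) := by
      have : rfTh 0 q 1 * rfTh 0 q (-1) * rfTh 0 (q ^ 2) 1 * (rfTh 0 q 1 - rfTh 0 q (-1)) / 2 * ((rfTh 0 q 1 + rfTh 0 q (-1)) / 2)
        = rfTh 0 q 1 * rfTh 0 q (-1) * rfTh 0 (q ^ 2) 1 * (rfTh 0 q 1 ^ 2 - rfTh 0 q (-1) ^ 2) / 4 := by ring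
      rw [this, ← k1, hJ, hn, rf_sqdiff hq hq1, rf_AP hq hq1, rf_R7 hq hq1, rf_AP2 hq hq1]
      field_simp
      norm_num
    exact mul_right_cancel₀ he h
  rw [← G]
  have L := rf_L hq hq1
  have w := rf_wron hq hq1
  apply mul_left_cancel₀ (mul_ne_zero ha he)
  generalize (∑' d : ℤ, (d : ℂ) * rfg2 q d) = G1 at *
  generalize (∑' d : ℤ, (d : ℂ) ^ 3 * rfg2 q d) = G3 at *
  generalize rfTh 0 q 1 = a at *
  generalize rfTh 0 q (-1) = b at *
  linear_combination (-a) * k3 + rfn2 q 1 * L + (12 * rfTh 2 q 1 + a * (2 * b ^ 4 - a ^ 4)) * k1 + 6 * G1 * w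

lemma rf_poly (a b c d e f h : ℂ) (r1 : a*b = d^2) (r2 : a^2+b^2=2*c^2) (r3 : a + b = 2*e) (s1 : c*d = f^2) (s2 : c^2+d^2 = 2*e^2) (s3 : c+d=2*h) :
  (a^4*c^3*e - 32/11*((c*a*(a^2-b^2)/4*(3/4*a*(a-b)*(a^2+b^2)+a*b*(a^2+b^2)-(a+b)^4/16))/2) - 8/11*(c*a^3*b^2*(a^2-b^2)/8)
   - 48/11*(c*a*b^2*(a^4-b^4)/16) - 136/11*(e*c^3*d^2*(c^2-d^2)/8) - 16/11*(e*c*d^2*(c^4-d^4)/16))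
  - (c^4*e^3*h - 32/11*((e*c*(c^2-d^2)/4*(3/4*c*(c-d)*(c^2+d^2)+c*d*(c^2+d^2)-(c+d)^4/16))/2) - 8/11*(e*c^3*d^2*(c^2-d^2)/8)
   - 48/11*(e*c*d^2*(c^4-d^4)/16) - 136/11*(h*e^3*f^2*(e^2-f^2)/8) - 16/11*(h*e*f^2*(e^4-f^4)/16))
  = 2/11*(c*d*e*(c-d)/2*(-c^4+3*c^3*d-3*c^2*d^2+3*c*d^3-d^4)/2) := by
  have he : e = (a+b)/2 := by linear_combination -r3/2
  have hh : h = (c+d)/2 := by linear_combination -s3/2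
  have hf4 : f^4 = c^2*d^2 := by linear_combination (-c*d-f^2)*s1
  have hc2 : c^2 = (a^2+b^2)/2 := by linear_combination -r2/2
  have hd2 : d^2 = a*b := by linear_combination -r1
  subst he hh
  rw [hf4, ← s1]
  have c3 : c^3 = c*((a^2+b^2)/2) := by rw [← hc2]; ring
  have c4 : c^4 = ((a^2+b^2)/2)^2 := by rw [← hc2]; ring
  have c5 : c^5 = c*((a^2+b^2)/2)^2 := by rw [← hc2]; ring
  have c6 : c^6 = ((a^2+b^2)/2)^3 := by rw [← hc2]; ring
  have c7 : c^7 = c*((a^2+b^2)/2)^3 := by rw [← hc2]; ring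
  have d3 : d^3 = d*(a*b) := by rw [← hd2]; ring
  have d4 : d^4 = (a*b)^2 := by rw [← hd2]; ring
  have d5 : d^5 = d*(a*b)^2 := by rw [← hd2]; ring
  have d6 : d^6 = (a*b)^3 := by rw [← hd2]; ring
  rw [← sub_eq_zero]
  ring_nf
  simp only [hc2, hd2, c3, c4, c5, c6, c7, d3, d4, d5, d6]
  ring

noncomputable def rfTT (q : ℂ) : ℂ := rfTh 0 q 1 ^ 4 * rfTh 0 (q ^ 2) 1 ^ 3 * rfTh 0 (q ^ 4) 1
noncomputable def rfE1 (q : ℂ) : ℂ := q * rfP (q ^ 2) ^ 11 * rfP (q ^ 8) ^ 2 / (rfP q ^ 2 * rfP (q ^ 4) ^ 3)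
noncomputable def rfE2 (q : ℂ) : ℂ := q * rfP q ^ 2 * rfP (q ^ 4) ^ 11 / (rfP (q ^ 2) ^ 3 * rfP (q ^ 8) ^ 2)
noncomputable def rfS1 (q : ℂ) : ℂ := (∑' d : ℤ, (d : ℂ) ^ 3 * rfg1 q d) / 2
noncomputable def rfF (q : ℂ) : ℂ := (∑' d : ℤ, (d : ℂ) ^ 3 * rfg2 q d) / 2

theorem rf_main {q : ℂ} (hq : q ≠ 0) (hq1 : ‖q‖ < 1) :
    (rfTT q - 32 / 11 * rfS1 q - 8 / 11 * rfE1 q - 48 / 11 * rfE2 q - 136 / 11 * rfE1 (q ^ 2) - 16 / 11 * rfE2 (q ^ 2))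
    - (rfTT (q ^ 2) - 32 / 11 * rfS1 (q ^ 2) - 8 / 11 * rfE1 (q ^ 2) - 48 / 11 * rfE2 (q ^ 2)
      - 136 / 11 * rfE1 ((q ^ 2) ^ 2) - 16 / 11 * rfE2 ((q ^ 2) ^ 2)) = 2 / 11 * rfF (q ^ 2) := by
  have hq2 : q ^ 2 ≠ 0 := pow_ne_zero _ hq
  have hq21 := rf_pow_lt hq1 two_ne_zero
  have hq4 : (q ^ 2) ^ 2 ≠ 0 := pow_ne_zero _ hq2
  have hq41 := rf_pow_lt hq21 two_ne_zero
  have r1 := rf_R1 hq hq1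
  have r2 := rf_R2 hq hq1
  have r3 := (rf_R3 hq hq1).1
  have s1 := rf_R1 hq2 hq21
  have s2 := rf_R2 hq2 hq21
  have s3 := (rf_R3 hq2 hq21).1
  have e4 : (q ^ 2) ^ 4 = ((q ^ 2) ^ 2) ^ 2 := by ring
  have e2 : q ^ 4 = (q ^ 2) ^ 2 := by ring
  rw [e4] at s3
  rw [e2] at r3
  have P := rf_poly _ _ _ _ _ _ _ r1 r2 r3 s1 s2 s3
  have k1 := rf_E1 hq hq1
  have k2 := rf_E1 hq2 hq21
  have k3 := rf_E1 hq4 hq41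
  have l1 := rf_E2 hq hq1
  have l2 := rf_E2 hq2 hq21
  have l3 := rf_E2 hq4 hq41
  change rfE1 _ = _ at k1 k2 k3
  change rfE2 _ = _ at l1 l2 l3
  rw [k1, k2, k3, l1, l2, l3, rfS1, rfS1, rfF, rf_G1 hq hq1, rf_G1 hq2 hq21, rf_G2 hq2 hq21, rfTT, rfTT, e4, e2]
  linear_combination P

lemma rf_uniq {f : ℕ → ℂ} (h : ∀ q : ℂ, q ≠ 0 → ‖q‖ < 1 → HasSum (fun n => f n * q ^ n) 0) : f = 0 := by
  set p : FormalMultilinearSeries ℂ ℂ ℂ := FormalMultilinearSeries.ofScalars ℂ f with hp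
  have hc : ∀ n, p.coeff n = f n := fun n => by
    rw [hp, FormalMultilinearSeries.coeff_ofScalars]
  set g : ℂ → ℂ := fun z => if z = 0 then f 0 else 0 with hg
  have hps : HasFPowerSeriesAt g p 0 := by
    rw [hasFPowerSeriesAt_iff]
    filter_upwards [Metric.ball_mem_nhds (0 : ℂ) one_pos] with z hz
    rw [zero_add]
    have hz1 : ‖z‖ < 1 := by simpa using hz
    by_cases h0 : z = 0
    · have := hasSum_single (f := fun n => z ^ n • p.coeff n) 0 (fun n hn => by simp [h0, hn])
      simpa [hg, h0, hc] using this
    · have e : g z = 0 := by simp [hg, h0]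
      rw [e]
      refine rf_hcongr (h z h0 hz1) (fun n => ?_) rfl
      rw [hc, smul_eq_mul, mul_comm]
  have hcont := hps.continuousAt
  have f0 : f 0 = 0 := by
    have h1 : Filter.Tendsto g (nhdsWithin 0 {0}ᶜ) (nhds (g 0)) := hcont.tendsto.mono_left nhdsWithin_le_nhds
    have h2 : Filter.Tendsto g (nhdsWithin 0 {0}ᶜ) (nhds 0) := by
      refine tendsto_const_nhds.congr' ?_
      filter_upwards [self_mem_nhdsWithin] with z hz
      have : z ≠ 0 := hz
      simp [hg, this]
    have := tendsto_nhds_unique h1 h2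
    simpa [hg] using this
  have g0 : g = 0 := by ext z; simp [hg, f0]
  rw [g0] at hps
  have := hps.eq_zero
  ext n
  rw [← hc, this]; simp [FormalMultilinearSeries.coeff]

lemma rf_dil {f : ℕ → ℂ} {q s : ℂ} (h : HasSum (fun n => f n * (q ^ 2) ^ n) s) :
    HasSum (fun n => (if 2 ∣ n then f (n / 2) else 0) * q ^ n) s := by
  have inj : Function.Injective (fun n : ℕ => 2 * n) := fun a b h => by simpa using h
  refine (inj.hasSum_iff (fun n hn => ?_)).mp (rf_hcongr h (fun n => ?_) rfl)
  · have : ¬ 2 ∣ n := fun ⟨k, hk⟩ => hn ⟨k, hk.symm⟩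
    simp [this]
  · simp [pow_mul]

theorem rf_assemble {N s1 s2 b1 b2 : ℕ → ℂ} {S2 : ℂ → ℂ}
    (hN : ∀ q : ℂ, q ≠ 0 → ‖q‖ < 1 → HasSum (fun n => N n * q ^ n) (rfTT q))
    (h1 : ∀ q : ℂ, q ≠ 0 → ‖q‖ < 1 → HasSum (fun n => s1 n * q ^ n) (rfS1 q))
    (h2 : ∀ q : ℂ, q ≠ 0 → ‖q‖ < 1 → HasSum (fun n => s2 n * q ^ n) (S2 q))
    (hF : ∀ q : ℂ, q ≠ 0 → ‖q‖ < 1 → rfF q = S2 q - S2 (q ^ 2))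
    (hb1 : ∀ q : ℂ, q ≠ 0 → ‖q‖ < 1 → HasSum (fun n => b1 n * q ^ n) (rfE1 q))
    (hb2 : ∀ q : ℂ, q ≠ 0 → ‖q‖ < 1 → HasSum (fun n => b2 n * q ^ n) (rfE2 q)) (n : ℕ) (hn : 0 < n) :
    N n = 32 / 11 * s1 n + 8 / 11 * b1 n + 48 / 11 * b2 n +
      (if 2 ∣ n then (2 / 11 * s2 (n / 2) + 136 / 11 * b1 (n / 2) + 16 / 11 * b2 (n / 2)) else 0) := by
  set C : ℕ → ℂ := fun n => N n - (32 / 11 * s1 n + 8 / 11 * b1 n + 48 / 11 * b2 n +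
      (if 2 ∣ n then (2 / 11 * s2 (n / 2) + 136 / 11 * b1 (n / 2) + 16 / 11 * b2 (n / 2)) else 0)) with hC
  set X : ℂ → ℂ := fun q => rfTT q - (32 / 11 * rfS1 q + 8 / 11 * rfE1 q + 48 / 11 * rfE2 q +
    (2 / 11 * S2 (q ^ 2) + 136 / 11 * rfE1 (q ^ 2) + 16 / 11 * rfE2 (q ^ 2))) with hX
  have hCX : ∀ q : ℂ, q ≠ 0 → ‖q‖ < 1 → HasSum (fun n => C n * q ^ n) (X q) := fun q hq hq1 => by
    have hq2 : q ^ 2 ≠ 0 := pow_ne_zero _ hq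
    have hq21 := rf_pow_lt hq1 two_ne_zero
    have H : HasSum (fun n => (2 / 11 * s2 n + 136 / 11 * b1 n + 16 / 11 * b2 n) * (q ^ 2) ^ n)
        (2 / 11 * S2 (q ^ 2) + 136 / 11 * rfE1 (q ^ 2) + 16 / 11 * rfE2 (q ^ 2)) := by
      refine rf_hcongr ((((h2 _ hq2 hq21).mul_left (2 / 11)).add ((hb1 _ hq2 hq21).mul_left (136 / 11))).add
        ((hb2 _ hq2 hq21).mul_left (16 / 11))) (fun n => ?_) rfl
      ring
    refine rf_hcongr ((hN q hq hq1).sub (((((h1 q hq hq1).mul_left (32 / 11)).add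
      ((hb1 q hq hq1).mul_left (8 / 11))).add ((hb2 q hq hq1).mul_left (48 / 11))).add (rf_dil H))) (fun n => ?_) rfl
    simp only [hC]
    ring
  have hXX : ∀ q : ℂ, q ≠ 0 → ‖q‖ < 1 → X q = X (q ^ 2) := fun q hq hq1 => by
    have hq2 : q ^ 2 ≠ 0 := pow_ne_zero _ hq
    have hq21 := rf_pow_lt hq1 two_ne_zero
    have M := rf_main hq hq1
    rw [hF _ hq2 hq21] at M
    simp only [hX]
    linear_combination M
  have hU := rf_uniq (f := fun n => C n - if 2 ∣ n then C (n / 2) else 0) (fun q hq hq1 => by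
    have hq2 : q ^ 2 ≠ 0 := pow_ne_zero _ hq
    have hq21 := rf_pow_lt hq1 two_ne_zero
    refine rf_hcongr ((hCX q hq hq1).sub (rf_dil (hCX _ hq2 hq21))) (fun n => by ring) ?_
    rw [hXX q hq hq1, sub_self])
  have hz : ∀ n, 0 < n → C n = 0 := by
    intro n
    induction n using Nat.strong_induction_on with
    | _ n ih =>
      intro hn
      have := congrFun hU n
      simp only [Pi.zero_apply] at this
      rw [sub_eq_zero.mp this]
      split_ifs with h
      · exact ih _ (by omega) (by omega)
      · rfl
  have := hz n hn
  simp only [hC] at this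
  exact sub_eq_zero.mp this

lemma rf_pnat {f : ℕ → ℂ} {s : ℂ} (h0 : f 0 = 0) : HasSum (fun n : ℕ+ => f n) s ↔ HasSum f s :=
  PNat.coe_injective.hasSum_iff (f := f) (fun n hn => by
    rcases Nat.eq_zero_or_pos n with h | h
    · rw [h, h0]
    · exact absurd ⟨⟨n, h⟩, rfl⟩ hn)

lemma rf_lam (c : ℕ → ℕ → ℂ) (hc : ∀ m d, ‖c m d‖ ≤ (d : ℝ) ^ 3) {q : ℂ} (hq1 : ‖q‖ < 1) :
    HasSum (fun n : ℕ => (∑ x ∈ n.divisorsAntidiagonal, c x.1 x.2) * q ^ n)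
      (∑' d : ℕ+, ∑' m : ℕ+, c m d * q ^ (m * d : ℕ)) := by
  have hs : Summable fun x : ℕ+ × ℕ+ => c x.1 x.2 * q ^ (x.1 * x.2 : ℕ) := by
    refine Summable.of_norm_bounded (summable_prod_mul_pow 3 hq1).norm fun x => ?_
    rw [norm_mul, norm_mul, norm_pow (x.2 : ℂ)]
    gcongr
    simpa using hc x.1 x.2
  have hT : ∑' d : ℕ+, ∑' m : ℕ+, c m d * q ^ (m * d : ℕ) = ∑' x : ℕ+ × ℕ+, c x.1 x.2 * q ^ (x.1 * x.2 : ℕ) := by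
    rw [hs.tsum_prod, Summable.tsum_comm]
    exact hs
  rw [hT]
  rw [← rf_pnat (by simp)]
  have h1 := (sigmaAntidiagonalEquivProd.hasSum_iff).mpr hs.hasSum
  have h2 := h1.sigma (fun n => hasSum_fintype _)
  refine rf_hcongr h2 (fun n => ?_) rfl
  simp only [Function.comp, sigmaAntidiagonalEquivProd, divisorsAntidiagonalFactors, Equiv.coe_fn_mk, PNat.mk_coe,
    Finset.univ_eq_attach]
  rw [(n : ℕ).divisorsAntidiagonal.sum_attach (fun x => c x.1 x.2 * q ^ (x.1 * x.2)), sum_mul]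
  refine sum_congr rfl fun x hx => ?_
  rw [(Nat.mem_divisorsAntidiagonal.mp hx).1]

lemma rf_chisum {x : ℂ} (hx : ‖x‖ < 1) :
    HasSum (fun k : ℕ => (ZMod.χ₈ (k : ZMod 8) : ℂ) * x ^ k) (x * (1 - x ^ 2) / (1 + x ^ 4)) := by
  have hs : Summable (fun k : ℕ => (ZMod.χ₈ (k : ZMod 8) : ℂ) * x ^ k) := by
    refine Summable.of_norm_bounded (summable_geometric_of_lt_one (norm_nonneg x) hx) fun k => ?_
    rw [norm_mul, norm_pow]
    exact mul_le_of_le_one_left (by positivity) (rf_chi_le _)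
  have h := hs.sum_add_tsum_nat_add 4
  have hc : ∀ a : ZMod 8, ZMod.χ₈ (a + 4) = - ZMod.χ₈ a := by decide
  have e : ∑' k : ℕ, (ZMod.χ₈ ((k + 4 : ℕ) : ZMod 8) : ℂ) * x ^ (k + 4) =
      -x ^ 4 * ∑' k : ℕ, (ZMod.χ₈ (k : ZMod 8) : ℂ) * x ^ k := by
    rw [← tsum_mul_left]
    congr 1; ext k
    push_cast
    rw [hc]; push_cast; ring
  rw [e] at h
  have c0 : ZMod.χ₈ 0 = 0 := by decide
  have c1 : ZMod.χ₈ 1 = 1 := by decide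
  have c2 : ZMod.χ₈ 2 = 0 := by decide
  have c3 : ZMod.χ₈ 3 = -1 := by decide
  simp only [sum_range_succ, range_zero, sum_empty, Nat.cast_zero, Nat.cast_one, Nat.cast_ofNat, c0, c1, c2, c3] at h
  have hne : 1 + x ^ 4 ≠ 0 := by
    intro h0
    have : x ^ 4 = -1 := by linear_combination h0
    have h1 := rf_pow_lt hx (n := 4) (by norm_num)
    rw [this] at h1
    norm_num at h1
  have : x * (1 - x ^ 2) / (1 + x ^ 4) = ∑' k : ℕ, (ZMod.χ₈ (k : ZMod 8) : ℂ) * x ^ k := by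
    rw [div_eq_iff hne]
    push_cast at h
    linear_combination h
  rw [this]
  exact hs.hasSum

lemma rf_half {g : ℤ → ℂ} (ho : ∀ d, g (-d) = - g d) (hs : Summable fun d : ℤ => ‖(d : ℂ) ^ 3 * g d‖) :
    (∑' d : ℤ, (d : ℂ) ^ 3 * g d) / 2 = ∑' d : ℕ+, (d : ℂ) ^ 3 * g d := by
  have h := tsum_int_eq_zero_add_two_mul_tsum_pnat (f := fun d : ℤ => (d : ℂ) ^ 3 * g d) (fun d => by
    simp only [ho]; push_cast; ring) hs.of_norm
  rw [h]; simp

lemma rf_s1 {q : ℂ} (hq : q ≠ 0) (hq1 : ‖q‖ < 1) : HasSum (fun n : ℕ =>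
    ((∑ d ∈ n.divisors, ZMod.χ₈ ((n / d : ℕ) : ZMod 8) * (d : ℤ) ^ 3 : ℤ) : ℂ) * q ^ n) (rfS1 q) := by
  have h := rf_lam (fun m d => (ZMod.χ₈ (m : ZMod 8) : ℂ) * (d : ℂ) ^ 3) (fun m d => by
    rw [norm_mul, norm_pow, Complex.norm_natCast]
    exact mul_le_of_le_one_left (by positivity) (rf_chi_le _)) hq1
  refine rf_hcongr h (fun n => ?_) ?_
  · simp only [Nat.sum_divisorsAntidiagonal' (fun i j => (ZMod.χ₈ (i : ZMod 8) : ℂ) * (j : ℂ) ^ 3)]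
    push_cast; rfl
  · rw [rfS1, rf_half (rfg1_odd hq) (rfg1_sum hq hq1 3)]
    congr 1; ext d
    have hd := rf_chisum (rf_pow_lt hq1 (n := d) d.ne_zero)
    rw [← rf_pnat (by simp)] at hd
    have := (hd.mul_left ((d : ℂ) ^ 3)).tsum_eq
    rw [rfg1]
    have z2 : q ^ (2 * ((d : ℕ) : ℤ)) = (q ^ (d : ℕ)) ^ 2 := by
      rw [rf_zp, zpow_natCast]; norm_cast
    have z4 : q ^ (4 * ((d : ℕ) : ℤ)) = (q ^ (d : ℕ)) ^ 4 := by
      rw [rf_zp, zpow_natCast]; norm_cast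
    rw [z2, z4, zpow_natCast, ← this]
    congr 1; ext m
    rw [← pow_mul, mul_comm (m : ℕ)]; ring

noncomputable def rfS2 (q : ℂ) : ℂ := ∑' d : ℕ+, ∑' m : ℕ+, (ZMod.χ₈ ((d : ℕ) : ZMod 8) : ℂ) * (d : ℂ) ^ 3 * q ^ (m * d : ℕ)

lemma rf_s2 {q : ℂ} (hq1 : ‖q‖ < 1) : HasSum (fun n : ℕ =>
    ((∑ d ∈ n.divisors, ZMod.χ₈ (d : ZMod 8) * (d : ℤ) ^ 3 : ℤ) : ℂ) * q ^ n) (rfS2 q) := by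
  have h := rf_lam (fun m d => (ZMod.χ₈ (d : ZMod 8) : ℂ) * (d : ℂ) ^ 3) (fun m d => by
    rw [norm_mul, norm_pow, Complex.norm_natCast]
    exact mul_le_of_le_one_left (by positivity) (rf_chi_le _)) hq1
  refine rf_hcongr h (fun n => ?_) rfl
  simp only [Nat.sum_divisorsAntidiagonal' (fun i j => (ZMod.χ₈ (j : ZMod 8) : ℂ) * (j : ℂ) ^ 3)]
  push_cast; rfl

lemma rf_geom1 {x : ℂ} (hx : ‖x‖ < 1) : HasSum (fun m : ℕ+ => x ^ (m : ℕ)) (x / (1 - x)) := by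
  have h := (hasSum_geometric_of_norm_lt_one hx).mul_left x
  have := (Equiv.pnatEquivNat.hasSum_iff).mpr h
  refine rf_hcongr this (fun m => ?_) (by rw [div_eq_mul_inv])
  simp only [Function.comp, Equiv.pnatEquivNat_apply]
  rw [← pow_succ']
  congr 1
  exact (PNat.natPred_add_one m).symm

lemma rf_S2eq {q : ℂ} (hq1 : ‖q‖ < 1) : rfS2 q =
    ∑' d : ℕ+, (ZMod.χ₈ ((d : ℕ) : ZMod 8) : ℂ) * (d : ℂ) ^ 3 * (q ^ (d : ℕ) / (1 - q ^ (d : ℕ))) := by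
  unfold rfS2
  congr 1; ext d
  rw [← (rf_geom1 (rf_pow_lt hq1 (n := d) d.ne_zero)).tsum_eq, ← tsum_mul_left]
  congr 1; ext m
  rw [← pow_mul, mul_comm (m : ℕ)]

lemma rf_S2sum {q : ℂ} (hq1 : ‖q‖ < 1) : Summable fun d : ℕ+ =>
    (ZMod.χ₈ ((d : ℕ) : ZMod 8) : ℂ) * (d : ℂ) ^ 3 * (q ^ (d : ℕ) / (1 - q ^ (d : ℕ))) := by
  have h := (summable_norm_pow_mul_geometric_div_one_sub (𝕜 := ℂ) 3 hq1).norm.comp_injective PNat.coe_injective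
  refine Summable.of_norm_bounded h fun d => ?_
  rw [mul_assoc, norm_mul]
  simp only [Function.comp]
  rw [← mul_div_assoc]
  exact mul_le_of_le_one_left (by positivity) (rf_chi_le _)

lemma rf_F {q : ℂ} (hq : q ≠ 0) (hq1 : ‖q‖ < 1) : rfF q = rfS2 q - rfS2 (q ^ 2) := by
  have hq21 := rf_pow_lt hq1 two_ne_zero
  rw [rf_S2eq hq1, rf_S2eq hq21, ← (rf_S2sum hq1).tsum_sub (rf_S2sum hq21), rfF,
    rf_half (rfg2_odd hq) (rfg2_sum hq hq1 3)]
  congr 1; ext d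
  rw [rfg2]
  have h1 := rf_one_sub_ne hq1 d.ne_zero
  have h2 := rf_one_sub_ne hq21 d.ne_zero
  have z2 : q ^ (2 * ((d : ℕ) : ℤ)) = (q ^ 2) ^ (d : ℕ) := by
    rw [mul_comm, rf_zp, zpow_natCast]; norm_cast
  rw [z2, zpow_natCast]
  push_cast
  field_simp
  ring

lemma rf_finprod : ∀ (n : ℕ) (f : Fin n → ℤ → ℂ), (∀ i, Summable fun j => ‖f i j‖) →
    Summable (fun x : Fin n → ℤ => ‖∏ i, f i (x i)‖) ∧
      ∑' x : Fin n → ℤ, ∏ i, f i (x i) = ∏ i, ∑' j, f i j := by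
  intro n
  induction n with
  | zero => intro f _; exact ⟨(hasSum_fintype _).summable, by simp⟩
  | succ n ih =>
    intro f hf
    obtain ⟨s, t⟩ := ih (fun i => f i.succ) (fun i => hf _)
    have e : ∀ p : ℤ × (Fin n → ℤ), ∏ i, f i ((Fin.consEquiv fun _ => ℤ) p i) =
        f 0 p.1 * ∏ i, f (Fin.succ i) (p.2 i) := fun p => by
      rw [Fin.prod_univ_succ]; simp [Fin.consEquiv]
    constructor
    · rw [← (Fin.consEquiv fun _ => ℤ).summable_iff]
      have := (hf 0).mul_norm s
      refine this.congr fun p => ?_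
      simp only [Function.comp, e]
    · rw [← (Fin.consEquiv fun _ => ℤ).tsum_eq, Fin.prod_univ_succ, ← t, tsum_mul_tsum_of_summable_norm (hf 0) s]
      simp only [e]

lemma rf_fiber {X : Type*} (g : X → ℕ) {q T : ℂ} (h : HasSum (fun x => q ^ g x) T) :
    HasSum (fun n => (Nat.card {x // g x = n} : ℂ) * q ^ n) T := by
  have h1 := (Equiv.sigmaFiberEquiv g).hasSum_iff.mpr h
  refine h1.sigma (fun n => ?_)
  have := (h1.summable.sigma_factor n)
  have e : ∀ c : {x // g x = n}, ((fun x => q ^ g x) ∘ (Equiv.sigmaFiberEquiv g)) ⟨n, c⟩ = q ^ n := fun c => by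
    simp [c.2]
  have h2 := this.hasSum
  simp only [e] at h2 ⊢
  rw [tsum_const, nsmul_eq_mul] at h2
  exact h2

lemma rf_zsum {ι : Type*} {q : ℂ} (hq : q ≠ 0) (s : Finset ι) (u : ι → ℤ) : q ^ (∑ i ∈ s, u i) = ∏ i ∈ s, q ^ u i := by
  classical
  induction s using Finset.induction_on with
  | empty => simp
  | insert i s hi ih => rw [sum_insert hi, prod_insert hi, zpow_add₀ hq, ih]

lemma rf_N {q : ℂ} (hq : q ≠ 0) (hq1 : ‖q‖ < 1) :
    HasSum (fun n => (repCount ![1, 1, 1, 1, 2, 2, 2, 4] n : ℂ) * q ^ n) (rfTT q) := by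
  set a : Fin 8 → ℕ := ![1, 1, 1, 1, 2, 2, 2, 4] with ha
  have ha0 : ∀ i, a i ≠ 0 := by rw [ha]; decide
  set Q : (Fin 8 → ℤ) → ℤ := fun x => ∑ i, (a i : ℤ) * x i ^ 2 with hQ
  have Q0 : ∀ x, 0 ≤ Q x := fun x => sum_nonneg fun i _ => by positivity
  have hs : ∀ i, Summable fun j : ℤ => ‖(q ^ a i) ^ (j ^ 2) * 1 ^ j‖ := fun i =>
    rf_gsum0 (pow_ne_zero _ hq) (rf_pow_lt hq1 (ha0 i)) one_ne_zero
  obtain ⟨s, t⟩ := rf_finprod 8 (fun i j => (q ^ a i) ^ (j ^ 2) * 1 ^ j) hs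
  have e : ∀ x : Fin 8 → ℤ, ∏ i, (q ^ a i) ^ (x i ^ 2) * 1 ^ (x i) = q ^ (Q x).toNat := fun x => by
    rw [← zpow_natCast, Int.toNat_of_nonneg (Q0 x), hQ]
    simp only [one_zpow, mul_one]
    rw [show (∏ i, (q ^ a i) ^ (x i ^ 2)) = ∏ i, q ^ ((a i : ℤ) * x i ^ 2) from prod_congr rfl fun i _ => rf_pz _ _ _]
    exact (rf_zsum hq _ _).symm
  have H : HasSum (fun x => q ^ (Q x).toNat) (rfTT q) := by
    refine rf_hcongr s.of_norm.hasSum (fun x => (e x).symm) ?_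
    rw [t, rfTT]
    have r : ∀ p : ℂ, ∑' j : ℤ, p ^ (j ^ 2) * 1 ^ j = rfTh 0 p 1 := fun p => by simp [rfTh]
    simp only [r, Fin.prod_univ_eight, ha]
    simp
    left
    ring
  refine rf_hcongr (rf_fiber _ H) (fun n => ?_) rfl
  congr 2
  refine Nat.card_congr (Equiv.subtypeEquivRight fun x => ?_)
  have := Q0 x
  change Q x = n ↔ _
  omega

lemma rf_eta {z : ℂ} (k : ℕ) : dedekindEta (k * z) =
    Complex.exp (Real.pi * Complex.I * z / 12) ^ k * rfP (Complex.exp (2 * Real.pi * Complex.I * z) ^ k) := by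
  rw [dedekindEta, rfP, ← Complex.exp_nat_mul]
  congr 2
  · ring
  · ext m
    rw [← pow_mul, ← Complex.exp_nat_mul]
    congr 2
    push_cast; ring

lemma rf_exq {q : ℂ} (hq : q ≠ 0) (hq1 : ‖q‖ < 1) : ∃ z : ℂ, 0 < z.im ∧ Complex.exp (2 * Real.pi * Complex.I * z) = q := by
  have hp : (2 * Real.pi * Complex.I : ℂ) ≠ 0 := by simp [Real.pi_ne_zero]
  refine ⟨Complex.log q / (2 * Real.pi * Complex.I), ?_, ?_⟩
  · have : Complex.log q / (2 * Real.pi * Complex.I) = ((-1 / (2 * Real.pi) : ℝ) : ℂ) * (Complex.I * Complex.log q) := by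
      have : (Real.pi : ℂ) ≠ 0 := by simp [Real.pi_ne_zero]
      push_cast
      field_simp
      rw [Complex.I_sq]; ring
    rw [this, Complex.im_ofReal_mul, Complex.I_mul_im, Complex.log_re]
    have h1 := Real.log_neg (norm_pos_iff.mpr hq) hq1
    exact mul_pos_of_neg_of_neg (div_neg_of_neg_of_pos (by norm_num) (by positivity)) h1
  · rw [mul_div_cancel₀ _ hp, Complex.exp_log hq]

lemma rf_ext {a : ℕ → ℤ} {q s : ℂ} (h : s = ∑' m : ℕ, (a (m + 1) : ℂ) * q ^ (m + 1)) (hs : s ≠ 0) :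
    HasSum (fun n => (if n = 0 then 0 else (a n : ℂ)) * q ^ n) s := by
  have h1 : Summable fun m : ℕ => (a (m + 1) : ℂ) * q ^ (m + 1) := by
    by_contra hc
    rw [tsum_eq_zero_of_not_summable hc] at h
    exact hs h
  have h2 := h1.hasSum
  rw [← h] at h2
  have := (hasSum_nat_add_iff (f := fun n => (if n = 0 then 0 else (a n : ℂ)) * q ^ n) 1).mp (rf_hcongr h2 (fun n => by simp) rfl)
  simpa using this

lemma rf_P8ne {q : ℂ} (hq1 : ‖q‖ < 1) : rfP q ≠ 0 ∧ rfP (q ^ 2) ≠ 0 ∧ rfP (q ^ 4) ≠ 0 ∧ rfP (q ^ 8) ≠ 0 :=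
  ⟨rfP_ne hq1, rfP_ne (rf_pow_lt hq1 two_ne_zero), rfP_ne (rf_pow_lt hq1 (by norm_num)),
    rfP_ne (rf_pow_lt hq1 (by norm_num))⟩

lemma rf_etas (z : ℂ) : ∃ ρ : ℂ, ρ ≠ 0 ∧ ρ ^ 24 = Complex.exp (2 * Real.pi * Complex.I * z) ∧
    dedekindEta z = ρ * rfP (Complex.exp (2 * Real.pi * Complex.I * z)) ∧
    dedekindEta (2 * z) = ρ ^ 2 * rfP (Complex.exp (2 * Real.pi * Complex.I * z) ^ 2) ∧
    dedekindEta (4 * z) = ρ ^ 4 * rfP (Complex.exp (2 * Real.pi * Complex.I * z) ^ 4) ∧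
    dedekindEta (8 * z) = ρ ^ 8 * rfP (Complex.exp (2 * Real.pi * Complex.I * z) ^ 8) := by
  refine ⟨Complex.exp (Real.pi * Complex.I * z / 12), Complex.exp_ne_zero _, ?_, ?_, ?_, ?_, ?_⟩
  · rw [← Complex.exp_nat_mul]; congr 1; push_cast; ring
  · simpa using rf_eta (z := z) 1
  · simpa using rf_eta (z := z) 2
  · simpa using rf_eta (z := z) 4
  · simpa using rf_eta (z := z) 8

lemma rf_b1 {a1 : ℕ → ℤ} (ha1 : ∀ z : ℂ, 0 < z.im →
      dedekindEta z ^ (-2 : ℤ) * dedekindEta (2 * z) ^ (11 : ℤ) * dedekindEta (4 * z) ^ (-3 : ℤ) * dedekindEta (8 * z) ^ (2 : ℤ)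
        = ∑' m : ℕ, (a1 (m + 1) : ℂ) * Complex.exp (2 * Real.pi * Complex.I * z) ^ (m + 1))
    {q : ℂ} (hq : q ≠ 0) (hq1 : ‖q‖ < 1) :
    HasSum (fun n => (if n = 0 then 0 else (a1 n : ℂ)) * q ^ n) (rfE1 q) := by
  obtain ⟨z, hz, hzq⟩ := rf_exq hq hq1
  obtain ⟨ρ, h0, h24, e1, e2, e4, e8⟩ := rf_etas z
  have h := ha1 z hz
  rw [e1, e2, e4, e8] at h
  rw [hzq] at h h24
  obtain ⟨p1, p2, p4, p8⟩ := rf_P8ne hq1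
  refine rf_ext (Eq.trans ?_ h) ?_
  · clear h
    unfold rfE1
    generalize rfP (q ^ 8) = f8 at *
    generalize rfP (q ^ 4) = f4 at *
    generalize rfP (q ^ 2) = f2 at *
    generalize rfP q = f1 at *
    rw [← h24]
    simp only [zpow_neg, zpow_ofNat]
    field_simp
  · unfold rfE1
    positivity

lemma rf_b2 {a2 : ℕ → ℤ} (ha2 : ∀ z : ℂ, 0 < z.im →
      dedekindEta z ^ (2 : ℤ) * dedekindEta (2 * z) ^ (-3 : ℤ) * dedekindEta (4 * z) ^ (11 : ℤ) * dedekindEta (8 * z) ^ (-2 : ℤ)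
        = ∑' m : ℕ, (a2 (m + 1) : ℂ) * Complex.exp (2 * Real.pi * Complex.I * z) ^ (m + 1))
    {q : ℂ} (hq : q ≠ 0) (hq1 : ‖q‖ < 1) :
    HasSum (fun n => (if n = 0 then 0 else (a2 n : ℂ)) * q ^ n) (rfE2 q) := by
  obtain ⟨z, hz, hzq⟩ := rf_exq hq hq1
  obtain ⟨ρ, h0, h24, e1, e2, e4, e8⟩ := rf_etas z
  have h := ha2 z hz
  rw [e1, e2, e4, e8] at h
  rw [hzq] at h h24
  obtain ⟨p1, p2, p4, p8⟩ := rf_P8ne hq1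
  refine rf_ext (Eq.trans ?_ h) ?_
  · clear h
    unfold rfE2
    generalize rfP (q ^ 8) = f8 at *
    generalize rfP (q ^ 4) = f4 at *
    generalize rfP (q ^ 2) = f2 at *
    generalize rfP q = f1 at *
    rw [← h24]
    simp only [zpow_neg, zpow_ofNat]
    field_simp
  · unfold rfE2
    positivity

theorem representation_formula_9
    (a1 a2 : ℕ → ℤ)
    (ha1 : ∀ z : ℂ, 0 < z.im →
      dedekindEta z ^ (-2 : ℤ) * dedekindEta (2 * z) ^ (11 : ℤ) * dedekindEta (4 * z) ^ (-3 : ℤ) * dedekindEta (8 * z) ^ (2 : ℤ)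
        = ∑' m : ℕ, (a1 (m + 1) : ℂ) * Complex.exp (2 * Real.pi * Complex.I * z) ^ (m + 1))
    (ha2 : ∀ z : ℂ, 0 < z.im →
      dedekindEta z ^ (2 : ℤ) * dedekindEta (2 * z) ^ (-3 : ℤ) * dedekindEta (4 * z) ^ (11 : ℤ) * dedekindEta (8 * z) ^ (-2 : ℤ)
        = ∑' m : ℕ, (a2 (m + 1) : ℂ) * Complex.exp (2 * Real.pi * Complex.I * z) ^ (m + 1))
    (n : ℕ) (hn : 0 < n) :
    (repCount ![1, 1, 1, 1, 2, 2, 2, 4] n : ℚ) =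
    (((32 : ℚ) / 11) * (sigmaChi8One n : ℚ) + ((2 : ℚ) / 11) * half sigmaOneChi8 n
      + ((8 : ℚ) / 11) * (a1 n : ℚ) + ((48 : ℚ) / 11) * (a2 n : ℚ)
      + ((136 : ℚ) / 11) * half a1 n + ((16 : ℚ) / 11) * half a2 n) := by
  have M := rf_assemble (fun q hq hq1 => rf_N hq hq1) (fun q hq hq1 => rf_s1 hq hq1)
    (fun q _ hq1 => rf_s2 hq1) (fun q hq hq1 => rf_F hq hq1)
    (fun q hq hq1 => rf_b1 ha1 hq hq1) (fun q hq hq1 => rf_b2 ha2 hq hq1) n hn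
  have hn0 : n ≠ 0 := hn.ne'
  have key : (((repCount ![1, 1, 1, 1, 2, 2, 2, 4] n : ℚ)) : ℂ) =
    ((((32 : ℚ) / 11) * (sigmaChi8One n : ℚ) + ((2 : ℚ) / 11) * half sigmaOneChi8 n
      + ((8 : ℚ) / 11) * (a1 n : ℚ) + ((48 : ℚ) / 11) * (a2 n : ℚ)
      + ((136 : ℚ) / 11) * half a1 n + ((16 : ℚ) / 11) * half a2 n : ℚ) : ℂ) := by
    rw [Rat.cast_natCast, M]
    by_cases h2 : 2 ∣ n
    · have h3 : n / 2 ≠ 0 := by omega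
      simp only [if_pos h2, if_neg hn0, if_neg h3, half, sigmaChi8One, sigmaOneChi8]
      push_cast
      ring
    · simp only [if_neg h2, if_neg hn0, half, sigmaChi8One]
      push_cast
      ring
  exact_mod_cast key
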